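/- arXiv:2407.15115 — 6 statements merged into one kernel-verified Lean document; each statement's English description precedes it below -/
import Mathlib

section
/- Let Φ ∈ ℝ and define the Aharonov–Bohm vector potential A : ℝ³ \ {x₁=x₂=0} → ℝ³ by A(x) = (Φ/(2π))·(-x₂, x₁, 0)/(x₁²+x₂²). Then for every smooth compactly supported vector field f = (f₁,f₂,f₃) ∈ C_c^∞(ℝ³;ℝ³) one has ∫_{ℝ³} A(x)·(∇×f)(x) dx = Φ·∫_ℝ f₃(0,0,t) dt, where ∇×f = (∂₂f₃-∂₃f₂, ∂₃f₁-∂₁f₃, ∂₁f₂-∂₂f₁). In other words, in the sense of distributions ∇×A equals Φ times the 2D Dirac delta concentrated on the x₃-axis times the unit vector e₃. -/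
open MeasureTheory
open scoped Real

noncomputable section

/-- The Aharonov–Bohm vector potential on `ℝ³`:
`A(x) = (Φ/(2π)) · (-x₂, x₁, 0) / (x₁² + x₂²)`. -/
def ABpot3 (Φ : ℝ) (x : Fin 3 → ℝ) : Fin 3 → ℝ :=
  fun i => Φ / (2 * π) * (![-(x 1), x 0, 0] i) / ((x 0) ^ 2 + (x 1) ^ 2)

/-- Partial derivative of a scalar function on `ℝ³` in the `i`-th coordinate direction. -/
def pd3 (i : Fin 3) (g : (Fin 3 → ℝ) → ℝ) (x : Fin 3 → ℝ) : ℝ :=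
  fderiv ℝ g x (Pi.single i 1)

/-- The curl `∇ × f = (∂₂f₃-∂₃f₂, ∂₃f₁-∂₁f₃, ∂₁f₂-∂₂f₁)` of a vector field on `ℝ³`. -/
def curl3 (f : (Fin 3 → ℝ) → Fin 3 → ℝ) (x : Fin 3 → ℝ) : Fin 3 → ℝ :=
  ![pd3 1 (fun y => f y 2) x - pd3 2 (fun y => f y 1) x,
    pd3 2 (fun y => f y 0) x - pd3 0 (fun y => f y 2) x,
    pd3 0 (fun y => f y 1) x - pd3 1 (fun y => f y 0) x]

open Set

/-- Cylindrical coordinates `(t, (r, θ)) ↦ (r cos θ, r sin θ, t)`. -/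
def cylindrical (q : ℝ × (ℝ × ℝ)) : Fin 3 → ℝ :=
  ![q.2.1 * Real.cos q.2.2, q.2.1 * Real.sin q.2.2, q.1]

/-- Lebesgue measure on the parameter domain of cylindrical coordinates. -/
def cylindricalMeasure : Measure (ℝ × (ℝ × ℝ)) :=
  (volume : Measure ℝ).prod ((volume : Measure (ℝ × ℝ)).restrict polarCoord.target)

lemma continuous_cylindrical : Continuous cylindrical := by
  unfold cylindrical
  refine continuous_pi fun i => ?_
  fin_cases i <;> simp <;> fun_prop

lemma map_polarCoord_symm_withDensity :
    Measure.map polarCoord.symm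
      (((volume : Measure (ℝ × ℝ)).restrict polarCoord.target).withDensity
        fun p => ENNReal.ofReal p.1) = volume := by
  refine Measure.ext_of_lintegral _ fun φ hφ => ?_
  have hm : Measurable (polarCoord.symm : ℝ × ℝ → ℝ × ℝ) :=
    continuous_polarCoord_symm.measurable
  rw [lintegral_map hφ hm, lintegral_withDensity_eq_lintegral_mul _ (by fun_prop)
    (show Measurable fun p => φ (polarCoord.symm p) from hφ.comp hm), ← lintegral_comp_polarCoord_symm]
  rfl

lemma measurePreserving_vecCons3 :
    MeasurePreserving (fun p : ℝ × (ℝ × ℝ) => (![p.2.1, p.2.2, p.1] : Fin 3 → ℝ)) := by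
  have h1 := (volume_preserving_piFinSuccAbove (fun _ : Fin 3 => ℝ) 2).symm
  have h2 := (MeasurePreserving.id (volume : Measure ℝ)).prod
    (volume_preserving_finTwoArrow ℝ).symm
  have h3 := h1.comp h2
  rw [← Measure.volume_eq_prod] at h3
  convert h3 using 1
  funext p
  funext i
  fin_cases i <;> rfl

lemma map_cylindrical_withDensity :
    Measure.map cylindrical (cylindricalMeasure.withDensity fun q => ENNReal.ofReal q.2.1) =
      volume := by
  have hm : Measurable (polarCoord.symm : ℝ × ℝ → ℝ × ℝ) :=
    continuous_polarCoord_symm.measurable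
  have h := Measure.map_prod_map (volume : Measure ℝ)
    (((volume : Measure (ℝ × ℝ)).restrict polarCoord.target).withDensity
      fun p => ENNReal.ofReal p.1) measurable_id hm
  rw [map_polarCoord_symm_withDensity, Measure.map_id, prod_withDensity_right (by fun_prop)] at h
  rw [← measurePreserving_vecCons3.map_eq, Measure.volume_eq_prod, h,
    Measure.map_map measurePreserving_vecCons3.measurable (measurable_id.prodMap hm)]
  rfl

lemma ae_cylindricalMeasure_pos : ∀ᵐ q ∂cylindricalMeasure, 0 < q.2.1 := by
  have h : ∀ᵐ p ∂((volume : Measure (ℝ × ℝ)).restrict polarCoord.target), 0 < p.1 := by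
    filter_upwards [ae_restrict_mem polarCoord.open_target.measurableSet] with p hp
    exact hp.1
  exact Measure.quasiMeasurePreserving_snd.ae h

lemma integral_eq_integral_cylindrical {F : (Fin 3 → ℝ) → ℝ} (hF : Measurable F) :
    ∫ x, F x = ∫ q, q.2.1 * F (cylindrical q) ∂cylindricalMeasure := by
  rw [← map_cylindrical_withDensity, integral_map continuous_cylindrical.aemeasurable
    hF.aestronglyMeasurable, integral_withDensity_eq_integral_toReal_smul (by fun_prop) (by simp)]
  refine integral_congr_ae ?_
  filter_upwards [ae_cylindricalMeasure_pos] with q hq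
  simp [ENNReal.toReal_ofReal hq.le]

lemma exists_bound_of_cylindrical_ne_zero {G : (Fin 3 → ℝ) → ℝ} (hG : HasCompactSupport G) :
    ∃ R : ℝ, ∀ q, G (cylindrical q) ≠ 0 → |q.1| ≤ R ∧ |q.2.1| ≤ R := by
  obtain ⟨R, hR⟩ := hG.isCompact.isBounded.exists_norm_le
  refine ⟨2 * R, fun q hq => ?_⟩
  have hn := hR _ (subset_tsupport _ hq)
  have hR0 : 0 ≤ R := (norm_nonneg _).trans hn
  have h0 := (norm_le_pi_norm (cylindrical q) 0).trans hn
  have h1 := (norm_le_pi_norm (cylindrical q) 1).trans hn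
  have h2 := (norm_le_pi_norm (cylindrical q) 2).trans hn
  simp only [cylindrical, Real.norm_eq_abs] at h0 h1 h2
  simp at h0 h1 h2
  refine ⟨by linarith, abs_le_of_sq_le_sq ?_ (by linarith)⟩
  rw [← abs_mul] at h0 h1
  have h0' := sq_le_sq' (abs_le.1 h0).1 (abs_le.1 h0).2
  have h1' := sq_le_sq' (abs_le.1 h1).1 (abs_le.1 h1).2
  nlinarith [Real.sin_sq_add_cos_sq q.2.2]

lemma integrable_mul_comp_cylindrical {c : ℝ × (ℝ × ℝ) → ℝ} (hc : Continuous c)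
    {G : (Fin 3 → ℝ) → ℝ} (hGc : Continuous G) (hG : HasCompactSupport G) :
    Integrable (fun q => c q * G (cylindrical q)) cylindricalMeasure := by
  obtain ⟨R, hR⟩ := exists_bound_of_cylindrical_ne_zero hG
  have hcont : Continuous fun q => c q * G (cylindrical q) :=
    hc.mul (hGc.comp continuous_cylindrical)
  have hμ : cylindricalMeasure =
      (volume : Measure (ℝ × (ℝ × ℝ))).restrict (univ ×ˢ polarCoord.target) := by
    rw [Measure.volume_eq_prod, ← Measure.prod_restrict, Measure.restrict_univ]
    rfl
  have hK : IsCompact (Icc (-R) R ×ˢ (Icc (-R) R ×ˢ Icc (-Real.pi) Real.pi)) :=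
    isCompact_Icc.prod (isCompact_Icc.prod isCompact_Icc)
  rw [hμ]
  refine IntegrableOn.of_forall_sdiff_eq_zero (hcont.continuousOn.integrableOn_compact hK)
    (MeasurableSet.univ.prod polarCoord.open_target.measurableSet) fun q hq => ?_
  by_contra hne
  have hb := hR q (right_ne_zero_of_mul hne)
  exact hq.2 ⟨abs_le.1 hb.1, abs_le.1 hb.2, hq.1.2.2.1.le, hq.1.2.2.2.le⟩

lemma continuous_pd3 {g : (Fin 3 → ℝ) → ℝ} (hg : ContDiff ℝ 1 g) (i : Fin 3) :
    Continuous (pd3 i g) :=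
  (hg.continuous_fderiv one_ne_zero).clm_apply continuous_const

lemma HasCompactSupport.pd3 {g : (Fin 3 → ℝ) → ℝ} (hg : HasCompactSupport g) (i : Fin 3) :
    HasCompactSupport (pd3 i g) :=
  hg.fderiv_apply ℝ _

lemma hasDerivAt_comp_cylindrical_axial {g : (Fin 3 → ℝ) → ℝ} (hg : ContDiff ℝ 1 g)
    (p : ℝ × ℝ) (t : ℝ) :
    HasDerivAt (fun s => g (cylindrical (s, p))) (pd3 2 g (cylindrical (t, p))) t := by
  have h : HasDerivAt (fun s => cylindrical (s, p)) (Pi.single 2 1) t := by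
    rw [hasDerivAt_pi]
    intro i
    fin_cases i
    · simpa [cylindrical] using hasDerivAt_const t _
    · simpa [cylindrical] using hasDerivAt_const t _
    · simpa [cylindrical] using hasDerivAt_id' t
  exact (hg.differentiable one_ne_zero _).hasFDerivAt.comp_hasDerivAt t h

lemma hasDerivAt_comp_cylindrical_radial {g : (Fin 3 → ℝ) → ℝ} (hg : ContDiff ℝ 1 g)
    (t r θ : ℝ) :
    HasDerivAt (fun s => g (cylindrical (t, (s, θ))))
      (Real.cos θ * pd3 0 g (cylindrical (t, (r, θ))) +
        Real.sin θ * pd3 1 g (cylindrical (t, (r, θ)))) r := by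
  have h : HasDerivAt (fun s => cylindrical (t, (s, θ)))
      (Real.cos θ • Pi.single 0 1 + Real.sin θ • Pi.single 1 1) r := by
    rw [hasDerivAt_pi]
    intro i
    fin_cases i
    · simpa [cylindrical] using (hasDerivAt_id r).mul_const (Real.cos θ)
    · simpa [cylindrical] using (hasDerivAt_id r).mul_const (Real.sin θ)
    · simpa [cylindrical] using hasDerivAt_const r t
  have h' := (hg.differentiable one_ne_zero (cylindrical (t, (r, θ)))).hasFDerivAt.comp_hasDerivAt
    r h
  simpa only [map_add, map_smul, smul_eq_mul] using! h'

lemma contDiff_cylindrical : ContDiff ℝ 1 cylindrical := by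
  unfold cylindrical
  rw [contDiff_pi]
  intro i
  fin_cases i <;> simp <;> fun_prop

lemma integral_axial_deriv_eq_zero {c : ℝ → ℝ} (hc : Continuous c)
    {g : (Fin 3 → ℝ) → ℝ} (hg : ContDiff ℝ 1 g) (hs : HasCompactSupport g) :
    ∫ q, c q.2.2 * pd3 2 g (cylindrical q) ∂cylindricalMeasure = 0 := by
  have hi := integrable_mul_comp_cylindrical (c := fun q => c q.2.2) (by fun_prop)
    (continuous_pd3 hg 2) (hs.pd3 2)
  unfold cylindricalMeasure at hi ⊢
  rw [integral_prod_symm _ hi]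
  refine integral_eq_zero_of_ae (.of_forall fun p => ?_)
  obtain ⟨R, hR⟩ := exists_bound_of_cylindrical_ne_zero hs
  have hcs : HasCompactSupport fun s => g (cylindrical (s, p)) :=
    HasCompactSupport.of_support_subset_isCompact (isCompact_Icc (a := -R) (b := R))
      fun s hs => abs_le.1 (hR _ hs).1
  have hd : ContDiff ℝ 1 fun s => g (cylindrical (s, p)) :=
    hg.comp (contDiff_cylindrical.comp (by fun_prop))
  have hz := integral_eq_zero_of_hasDerivAt_of_integrable
    (fun t => (hd.differentiable one_ne_zero t).hasDerivAt)
    ((hd.continuous_deriv le_rfl).integrable_of_hasCompactSupport hcs.deriv)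
    (hd.continuous.integrable_of_hasCompactSupport hcs)
  simp only [(hasDerivAt_comp_cylindrical_axial hg p _).deriv] at hz
  simp [integral_const_mul, hz]

lemma integral_radial_deriv {g : (Fin 3 → ℝ) → ℝ} (hg : ContDiff ℝ 1 g)
    (hs : HasCompactSupport g) :
    ∫ q, (Real.cos q.2.2 * pd3 0 g (cylindrical q) + Real.sin q.2.2 * pd3 1 g (cylindrical q))
      ∂cylindricalMeasure = -(2 * Real.pi) * ∫ t : ℝ, g ![0, 0, t] := by
  have hi := (integrable_mul_comp_cylindrical (c := fun q => Real.cos q.2.2) (by fun_prop)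
    (continuous_pd3 hg 0) (hs.pd3 0)).add
    (integrable_mul_comp_cylindrical (c := fun q => Real.sin q.2.2) (by fun_prop)
    (continuous_pd3 hg 1) (hs.pd3 1))
  unfold cylindricalMeasure at hi ⊢
  rw [← integral_const_mul]
  refine (integral_prod _ hi).trans (integral_congr_ae ?_)
  filter_upwards [hi.prod_right_ae] with t ht
  have hμ : (volume : Measure (ℝ × ℝ)).restrict polarCoord.target =
      (volume.restrict (Ioi (0 : ℝ))).prod (volume.restrict (Ioo (-Real.pi) Real.pi)) := by
    rw [Measure.prod_restrict]
    rfl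
  rw [hμ] at ht ⊢
  refine (integral_prod_symm _ ht).trans ?_
  have hr (θ : ℝ) : ∫ r in Ioi (0 : ℝ), (Real.cos θ * pd3 0 g (cylindrical (t, (r, θ))) +
      Real.sin θ * pd3 1 g (cylindrical (t, (r, θ)))) = - g ![0, 0, t] := by
    obtain ⟨R, hR⟩ := exists_bound_of_cylindrical_ne_zero hs
    have hcs : HasCompactSupport fun r => g (cylindrical (t, (r, θ))) :=
      HasCompactSupport.of_support_subset_isCompact (isCompact_Icc (a := -R) (b := R))
        fun s hs => abs_le.1 (hR _ hs).2
    have hd : ContDiff ℝ 1 fun r => g (cylindrical (t, (r, θ))) :=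
      hg.comp (contDiff_cylindrical.comp (by fun_prop))
    have hz := HasCompactSupport.integral_Ioi_deriv_eq hd hcs 0
    simp only [(hasDerivAt_comp_cylindrical_radial hg t _ θ).deriv] at hz
    simpa [cylindrical] using hz
  refine (integral_congr_ae (.of_forall hr)).trans ?_
  have : Real.pi + Real.pi = 2 * Real.pi := by ring
  simp [Real.pi_pos.le, this]

lemma mul_abpot3_dot_curl3_cylindrical (Φ : ℝ) (f : (Fin 3 → ℝ) → Fin 3 → ℝ)
    {q : ℝ × (ℝ × ℝ)} (hq : 0 < q.2.1) :
    q.2.1 * ∑ i, ABpot3 Φ (cylindrical q) i * curl3 f (cylindrical q) i =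
      Φ / (2 * Real.pi) *
        (Real.cos q.2.2 * pd3 2 (fun y => f y 0) (cylindrical q) +
          Real.sin q.2.2 * pd3 2 (fun y => f y 1) (cylindrical q) -
          (Real.cos q.2.2 * pd3 0 (fun y => f y 2) (cylindrical q) +
            Real.sin q.2.2 * pd3 1 (fun y => f y 2) (cylindrical q))) := by
  have hρ : (cylindrical q 0) ^ 2 + (cylindrical q 1) ^ 2 = q.2.1 ^ 2 := by
    simp only [cylindrical, Matrix.cons_val_zero, Matrix.cons_val_one]
    linear_combination q.2.1 ^ 2 * Real.sin_sq_add_cos_sq q.2.2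
  have h0 : cylindrical q 0 = q.2.1 * Real.cos q.2.2 := rfl
  have h1 : cylindrical q 1 = q.2.1 * Real.sin q.2.2 := rfl
  simp only [ABpot3, curl3, Fin.sum_univ_three, hρ, Matrix.cons_val_zero, Matrix.cons_val_one,
    Matrix.cons_val]
  rw [h0, h1]
  field_simp
  ring

/-- In the sense of distributions, `∇ × A = Φ · δ_{(x₁,x₂)=(0,0)} · e₃`:
for every smooth compactly supported vector field `f`,
`∫ A · (∇×f) = Φ · ∫ f₃(0,0,t) dt`. -/
theorem ab_curl_is_delta (Φ : ℝ) (f : (Fin 3 → ℝ) → Fin 3 → ℝ)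
    (hf : ContDiff ℝ (⊤ : ℕ∞) f) (hsupp : HasCompactSupport f) :
    ∫ x : Fin 3 → ℝ, ∑ i, ABpot3 Φ x i * curl3 f x i =
      Φ * ∫ t : ℝ, f ![0, 0, t] 2 := by
  have hc (i : Fin 3) : ContDiff ℝ 1 fun y => f y i :=
    (contDiff_pi.1 hf i).of_le (by exact_mod_cast le_top)
  have hs (i : Fin 3) : HasCompactSupport fun y => f y i :=
    hsupp.comp_left (g := fun v : Fin 3 → ℝ => v i) rfl
  have hm : Measurable fun x => ∑ i, ABpot3 Φ x i * curl3 f x i := by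
    have hp (i j : Fin 3) := (continuous_pd3 (hc j) i).measurable
    simp only [ABpot3, curl3, Fin.sum_univ_three, Matrix.cons_val_zero, Matrix.cons_val_one,
      Matrix.cons_val]
    fun_prop
  have hi {c : ℝ → ℝ} (hcont : Continuous c) (i j : Fin 3) :=
    integrable_mul_comp_cylindrical (c := fun q => c q.2.2) (by fun_prop)
      (continuous_pd3 (hc j) i) ((hs j).pd3 i)
  rw [integral_eq_integral_cylindrical hm]
  calc
    _ = ∫ q, Φ / (2 * Real.pi) *
        (Real.cos q.2.2 * pd3 2 (fun y => f y 0) (cylindrical q) +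
          Real.sin q.2.2 * pd3 2 (fun y => f y 1) (cylindrical q) -
          (Real.cos q.2.2 * pd3 0 (fun y => f y 2) (cylindrical q) +
            Real.sin q.2.2 * pd3 1 (fun y => f y 2) (cylindrical q))) ∂cylindricalMeasure := by
      refine integral_congr_ae ?_
      filter_upwards [ae_cylindricalMeasure_pos] with q hq
      exact mul_abpot3_dot_curl3_cylindrical Φ f hq
    _ = Φ / (2 * Real.pi) * (0 + 0 - -(2 * Real.pi) * ∫ t : ℝ, f ![0, 0, t] 2) := by
      rw [integral_const_mul, integral_sub, integral_add,
        integral_axial_deriv_eq_zero Real.continuous_cos (hc 0) (hs 0),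
        integral_axial_deriv_eq_zero Real.continuous_sin (hc 1) (hs 1),
        integral_radial_deriv (hc 2) (hs 2)]
      · exact hi Real.continuous_cos 2 0
      · exact hi Real.continuous_sin 2 1
      · exact (hi Real.continuous_cos 2 0).add (hi Real.continuous_sin 2 1)
      · exact (hi Real.continuous_cos 0 2).add (hi Real.continuous_sin 1 2)
    _ = _ := by
      have := Real.pi_ne_zero
      field_simp
      ring

end
end

section
/- Let Φ ∈ ℝ and define A : ℝ³ \ {x₁=x₂=0} → ℝ³ by A(x) = (Φ/(2π))·(-x₂, x₁, 0)/(x₁²+x₂²). Then for every g ∈ C_c^∞(ℝ³;ℝ) one has ∫_{ℝ³} A(x)·∇g(x) dx = 0; that is, A is divergence-free in the sense of distributions (Coulomb gauge). -/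
open MeasureTheory
open scoped Real

noncomputable section

/-- A Bochner integral over a product vanishes as soon as all inner integrals do; integrability is
not needed because the integral of a non-integrable function is zero. -/
theorem integral_prod_eq_zero_of_inner {α β : Type*} [MeasurableSpace α] [MeasurableSpace β]
    {μ : Measure α} {ν : Measure β} [SFinite μ] [SFinite ν] {f : α × β → ℝ}
    (h : ∀ᵐ a ∂μ, ∫ b, f (a, b) ∂ν = 0) : ∫ p, f p ∂(μ.prod ν) = 0 := by
  by_cases hf : Integrable f (μ.prod ν)
  · rw [integral_prod f hf, integral_congr_ae h, integral_zero]
  · exact integral_undef hf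

/-- A function on the plane whose integral over every circle about the origin vanishes has
vanishing integral. -/
theorem integral_plane_eq_zero_of_circle {f : ℝ × ℝ → ℝ}
    (h : ∀ r : ℝ, 0 < r → ∫ θ in (-π)..π, f (r * Real.cos θ, r * Real.sin θ) = 0) :
    ∫ p, f p = 0 := by
  rw [← integral_comp_polarCoord_symm f, polarCoord_target, Measure.volume_eq_prod,
    ← Measure.prod_restrict]
  refine integral_prod_eq_zero_of_inner ?_
  filter_upwards [ae_restrict_mem measurableSet_Ioi] with r hr
  have := h r hr
  rw [intervalIntegral.integral_of_le (by linarith [Real.pi_pos]),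
    integral_Ioc_eq_integral_Ioo] at this
  simp only [polarCoord_symm_apply, smul_eq_mul, integral_const_mul, this, mul_zero]

/-- A function on `ℝ³` whose integral over every horizontal plane vanishes has vanishing
integral. -/
theorem integral_space_eq_zero_of_plane {f : (Fin 3 → ℝ) → ℝ}
    (h : ∀ z : ℝ, ∫ p : ℝ × ℝ, f ![p.1, p.2, z] = 0) : ∫ x, f x = 0 := by
  have e := (volume_preserving_piFinSuccAbove (fun _ : Fin 3 => ℝ) 2).symm
  rw [← e.integral_comp' f, Measure.volume_eq_prod]
  refine integral_prod_eq_zero_of_inner (Filter.Eventually.of_forall fun z => ?_)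
  have e₂ := (volume_preserving_finTwoArrow ℝ).symm
  rw [← e₂.integral_comp', ← h z]
  congr! 3 with p
  ext i
  fin_cases i <;> rfl

/-- The derivative of a function on `ℝ³` along a horizontal circle about the third axis. -/
theorem hasDerivAt_comp_circle {g : (Fin 3 → ℝ) → ℝ} (hg : Differentiable ℝ g) (r z θ : ℝ) :
    HasDerivAt (fun t => g ![r * Real.cos t, r * Real.sin t, z])
      (-(r * Real.sin θ) * pd3 0 g ![r * Real.cos θ, r * Real.sin θ, z] +
        r * Real.cos θ * pd3 1 g ![r * Real.cos θ, r * Real.sin θ, z]) θ := by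
  have hc : HasDerivAt (fun t : ℝ => (![r * Real.cos t, r * Real.sin t, z] : Fin 3 → ℝ))
      ![-(r * Real.sin θ), r * Real.cos θ, 0] θ := by
    rw [hasDerivAt_pi]
    intro i
    fin_cases i
    · simpa using (Real.hasDerivAt_cos θ).const_mul r
    · simpa using (Real.hasDerivAt_sin θ).const_mul r
    · simpa using hasDerivAt_const θ z
  have hv : (![-(r * Real.sin θ), r * Real.cos θ, 0] : Fin 3 → ℝ) =
      (-(r * Real.sin θ)) • Pi.single 0 1 + (r * Real.cos θ) • Pi.single 1 1 := by
    ext i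
    fin_cases i <;> simp
  have := (hg ![r * Real.cos θ, r * Real.sin θ, z]).hasFDerivAt.comp_hasDerivAt θ hc
  rw [hv, map_add, map_smul, map_smul] at this
  exact this

/-- The circulation of a gradient along a horizontal circle vanishes. -/
theorem integral_circle_pd3_eq_zero {g : (Fin 3 → ℝ) → ℝ} (hg : ContDiff ℝ 1 g) (r z : ℝ) :
    ∫ θ in (-π)..π, (-(r * Real.sin θ) * pd3 0 g ![r * Real.cos θ, r * Real.sin θ, z] +
        r * Real.cos θ * pd3 1 g ![r * Real.cos θ, r * Real.sin θ, z]) = 0 := by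
  have hpd : ∀ i, Continuous (pd3 i g) := fun i =>
    (hg.continuous_fderiv one_ne_zero).clm_apply continuous_const
  have hc : Continuous fun t : ℝ => (![r * Real.cos t, r * Real.sin t, z] : Fin 3 → ℝ) := by
    fun_prop
  rw [intervalIntegral.integral_eq_sub_of_hasDerivAt
    (fun θ _ => hasDerivAt_comp_circle (hg.differentiable one_ne_zero) r z θ)]
  · simp
  · have h₀ := (hpd 0).comp hc
    have h₁ := (hpd 1).comp hc
    simp only [Function.comp_def] at h₀ h₁
    exact Continuous.intervalIntegrable (by fun_prop) _ _

/-- The Aharonov–Bohm vector potential is divergence-free in the sense of distributions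
(Coulomb gauge): for every `g ∈ C_c^∞(ℝ³; ℝ)`, `∫ A · ∇g = 0`. -/
theorem ab_divergence_free (Φ : ℝ) (g : (Fin 3 → ℝ) → ℝ)
    (hg : ContDiff ℝ (⊤ : ℕ∞) g) (hsupp : HasCompactSupport g) :
    ∫ x : Fin 3 → ℝ, ∑ i, ABpot3 Φ x i * pd3 i g x = 0 := by
  refine integral_space_eq_zero_of_plane fun z => integral_plane_eq_zero_of_circle fun r _ => ?_
  refine Eq.trans ?_ (mul_zero (Φ / (2 * π) / r ^ 2))
  rw [← integral_circle_pd3_eq_zero (hg.of_le (by exact_mod_cast le_top)) r z,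
    ← intervalIntegral.integral_const_mul]
  refine intervalIntegral.integral_congr fun θ _ => ?_
  have hr2 : (r * Real.cos θ) ^ 2 + (r * Real.sin θ) ^ 2 = r ^ 2 := by
    linear_combination r ^ 2 * Real.cos_sq_add_sin_sq θ
  simp only [Fin.sum_univ_three, ABpot3, Matrix.cons_val, hr2]
  ring

end
end

section
/- Let α ∈ ℝ, ℓ ∈ ℤ, set ν = |ℓ+α|, and let μ ∈ ℂ with Re μ > 0. Define G(x) = K_ν(μ|x|)·u_ℓ(x) on ℝ² \ {0}. Then G satisfies the defect equation (H_α G)(x) = -μ²·G(x) for every x ∈ ℝ² \ {0}. In particular, for μ = e^{-iπ/4} (respectively μ = e^{+iπ/4}) one gets H_α G = +i·G (respectively H_α G = -i·G), so these functions solve the deficiency equations for the Aharonov–Bohm operator. -/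
open MeasureTheory
open scoped Real ComplexConjugate

noncomputable section

/-- Partial derivative of a complex-valued function on `ℝ²` in the `i`-th coordinate
direction. -/
def pd (i : Fin 2) (ψ : (Fin 2 → ℝ) → ℂ) (x : Fin 2 → ℝ) : ℂ :=
  fderiv ℝ ψ x (Pi.single i 1)

/-- The Aharonov–Bohm differential operator
`(H_α ψ)(x) = -Δψ(x) - (2iα/|x|²)·((-x₂,x₁)·∇ψ(x)) + (α²/|x|²)·ψ(x)`,
the expansion of `(-i∇ + A_α)² ψ` with `A_α(x) = α (-x₂,x₁)/|x|²`. -/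
def ABop (α : ℝ) (ψ : (Fin 2 → ℝ) → ℂ) (x : Fin 2 → ℝ) : ℂ :=
  -(pd 0 (pd 0 ψ) x + pd 1 (pd 1 ψ) x)
    - (2 * Complex.I * (α : ℂ) / (((x 0) ^ 2 + (x 1) ^ 2 : ℝ) : ℂ)) *
        (((-(x 1) : ℝ) : ℂ) * pd 0 ψ x + ((x 0 : ℝ) : ℂ) * pd 1 ψ x)
    + ((α ^ 2 / ((x 0) ^ 2 + (x 1) ^ 2) : ℝ) : ℂ) * ψ x

/-- The `ℓ`-th angular harmonic `u_ℓ(x) = ((x₁ + i x₂)/|x|)^ℓ = e^{iℓθ(x)}` on `ℝ² \ {0}`. -/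
def uang (ℓ : ℤ) (x : Fin 2 → ℝ) : ℂ :=
  (((x 0 : ℂ) + Complex.I * (x 1 : ℂ)) / ((Real.sqrt ((x 0) ^ 2 + (x 1) ^ 2) : ℝ) : ℂ)) ^ ℓ

/-- The modified Bessel function of the second kind,
`K_ν(z) = ∫₀^∞ e^{-z cosh t} cosh(νt) dt`, for `Re z > 0`. -/
def Kbessel (ν : ℝ) (z : ℂ) : ℂ :=
  ∫ t in Set.Ioi (0 : ℝ), Complex.exp (-z * (Real.cosh t : ℂ)) * ((Real.cosh (ν * t) : ℝ) : ℂ)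

/-- The integral `∫₀^∞ e^{-z cosh t} (cosh t)^n cosh(νt) dt`, which equals `(-1)^n K_ν^{(n)}(z)`
for `Re z > 0`. -/
def besselMoment (ν : ℝ) (n : ℕ) (z : ℂ) : ℂ :=
  ∫ t in Set.Ioi (0 : ℝ), Complex.exp (-z * (Real.cosh t : ℂ)) *
    ((Real.cosh t ^ n * Real.cosh (ν * t) : ℝ) : ℂ)

theorem Kbessel_eq_besselMoment (ν : ℝ) (z : ℂ) : Kbessel ν z = besselMoment ν 0 z := by
  simp [Kbessel, besselMoment]

theorem cosh_le_exp_abs (t : ℝ) : Real.cosh t ≤ Real.exp |t| := by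
  rw [← Real.cosh_abs, Real.cosh_eq]
  have : Real.exp (-|t|) ≤ Real.exp |t| := Real.exp_le_exp.2 (by linarith [abs_nonneg t])
  linarith

theorem abs_sinh_le_exp_abs (t : ℝ) : |Real.sinh t| ≤ Real.exp |t| := by
  rw [Real.abs_sinh, Real.sinh_eq]
  linarith [Real.exp_pos |t|, Real.exp_pos (-|t|)]

theorem sq_div_four_le_cosh {t : ℝ} (ht : 0 ≤ t) : t ^ 2 / 4 ≤ Real.cosh t := by
  rw [Real.cosh_eq]
  linarith [Real.quadratic_le_exp_of_nonneg ht, Real.exp_pos (-t)]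

theorem integrableOn_exp_neg_mul_cosh_mul {z : ℂ} (hz : 0 < z.re) {W : ℝ → ℝ}
    (hW : Continuous W) (a : ℝ) (ha : ∀ t, 0 < t → |W t| ≤ Real.exp (a * t)) :
    IntegrableOn (fun t => Complex.exp (-z * (Real.cosh t : ℂ)) * (W t : ℂ)) (Set.Ioi 0) := by
  have hg : Integrable (fun t : ℝ =>
      Complex.exp (-((z.re / 4 : ℝ) : ℂ) * (t : ℂ) ^ 2 + (a : ℂ) * t + 0)) :=
    integrable_cexp_quadratic (by rw [Complex.ofReal_re]; positivity) _ _
  refine Integrable.mono hg.integrableOn (by fun_prop) ?_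
  filter_upwards [ae_restrict_mem measurableSet_Ioi] with t ht
  rw [Set.mem_Ioi] at ht
  have h1 : (-((z.re / 4 : ℝ) : ℂ) * (t : ℂ) ^ 2 + (a : ℂ) * t + 0)
      = ((-(z.re / 4) * t ^ 2 + a * t : ℝ) : ℂ) := by push_cast; ring
  have h2 : (-z * (Real.cosh t : ℂ)).re = -z.re * Real.cosh t := by
    rw [Complex.re_mul_ofReal, Complex.neg_re]
  rw [norm_mul, Complex.norm_exp, Complex.norm_real, Real.norm_eq_abs, h1, Complex.norm_exp,
    Complex.ofReal_re, h2, Real.exp_add]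
  exact mul_le_mul (Real.exp_le_exp.2 (by nlinarith [sq_div_four_le_cosh ht.le])) (ha t ht)
    (abs_nonneg _) (Real.exp_pos _).le

theorem abs_cosh_pow_mul_cosh_le (ν : ℝ) (n : ℕ) {t : ℝ} (ht : 0 < t) :
    |Real.cosh t ^ n * Real.cosh (ν * t)| ≤ Real.exp ((n + |ν|) * t) := by
  rw [abs_of_nonneg (by positivity), add_mul, Real.exp_add, Real.exp_nat_mul]
  gcongr
  · simpa [abs_of_pos ht] using cosh_le_exp_abs t
  · simpa [abs_mul, abs_of_pos ht] using cosh_le_exp_abs (ν * t)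

theorem integrableOn_besselMoment (ν : ℝ) (n : ℕ) {z : ℂ} (hz : 0 < z.re) :
    IntegrableOn (fun t => Complex.exp (-z * (Real.cosh t : ℂ)) *
      ((Real.cosh t ^ n * Real.cosh (ν * t) : ℝ) : ℂ)) (Set.Ioi 0) :=
  integrableOn_exp_neg_mul_cosh_mul hz (by fun_prop) (n + |ν|)
    fun _ ht => abs_cosh_pow_mul_cosh_le ν n ht

theorem hasDerivAt_besselMoment (ν : ℝ) (n : ℕ) {z : ℂ} (hz : 0 < z.re) :
    HasDerivAt (besselMoment ν n) (-besselMoment ν (n + 1) z) z := by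
  have hs : {w : ℂ | z.re / 2 < w.re} ∈ nhds z :=
    (isOpen_lt continuous_const Complex.continuous_re).mem_nhds (half_lt_self hz)
  have hz2 : 0 < ((z.re / 2 : ℝ) : ℂ).re := by rw [Complex.ofReal_re]; positivity
  have key := (hasDerivAt_integral_of_dominated_loc_of_deriv_le
    (μ := volume.restrict (Set.Ioi (0 : ℝ)))
    (F := fun (w : ℂ) (t : ℝ) => Complex.exp (-w * (Real.cosh t : ℂ)) *
      ((Real.cosh t ^ n * Real.cosh (ν * t) : ℝ) : ℂ))
    (F' := fun (w : ℂ) (t : ℝ) => -(Complex.exp (-w * (Real.cosh t : ℂ)) *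
      ((Real.cosh t ^ (n + 1) * Real.cosh (ν * t) : ℝ) : ℂ)))
    (bound := fun t => ‖Complex.exp (-((z.re / 2 : ℝ) : ℂ) * (Real.cosh t : ℂ)) *
      ((Real.cosh t ^ (n + 1) * Real.cosh (ν * t) : ℝ) : ℂ)‖)
    hs (.of_forall fun w => by fun_prop) (integrableOn_besselMoment ν n hz)
    (by fun_prop) (.of_forall fun t w hw => ?_) (integrableOn_besselMoment ν (n + 1) hz2).norm
    (.of_forall fun t w hw => ?_)).2
  · rw [integral_neg] at key
    exact key
  · rw [norm_neg, norm_mul, norm_mul, Complex.norm_exp, Complex.norm_exp, Complex.re_mul_ofReal,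
      Complex.re_mul_ofReal, Complex.neg_re, Complex.neg_re, Complex.ofReal_re]
    have := Real.cosh_pos t
    have hw' : z.re / 2 < w.re := hw
    gcongr
  · have h := (((hasDerivAt_id w).neg.mul_const (Real.cosh t : ℂ)).cexp).mul_const
      ((Real.cosh t ^ n * Real.cosh (ν * t) : ℝ) : ℂ)
    refine h.congr_deriv ?_
    simp only [Pi.neg_apply, id]
    push_cast
    ring

/-- The modified Bessel equation, in terms of the moments. -/
theorem sq_mul_besselMoment_two (ν : ℝ) {z : ℂ} (hz : 0 < z.re) :
    z ^ 2 * besselMoment ν 2 z =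
      z * besselMoment ν 1 z + (ν ^ 2 + z ^ 2) * besselMoment ν 0 z := by
  let E : ℝ → ℂ := fun t => Complex.exp (-z * (Real.cosh t : ℂ))
  let F : ℝ → ℂ := fun t => -z * (E t * ((Real.sinh t * Real.cosh (ν * t) : ℝ) : ℂ))
    - ν * (E t * (Real.sinh (ν * t) : ℂ))
  let B : ℕ → ℝ → ℂ := fun n t => E t * ((Real.cosh t ^ n * Real.cosh (ν * t) : ℝ) : ℂ)
  have hB : ∀ n, IntegrableOn (B n) (Set.Ioi 0) := fun n => integrableOn_besselMoment ν n hz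
  let F' : ℝ → ℂ := fun t => z ^ 2 * B 2 t - z * B 1 t - (ν ^ 2 + z ^ 2) * B 0 t
  have hderiv : ∀ t, HasDerivAt F (F' t) t := by
    intro t
    have hν : HasDerivAt (fun t : ℝ => ν * t) ν t := by
      simpa using (hasDerivAt_id t).const_mul ν
    have hE : HasDerivAt E (E t * (-z * (Real.sinh t : ℂ))) t :=
      ((Real.hasDerivAt_cosh t).ofReal_comp.const_mul (-z)).cexp
    have h1 := ((Real.hasDerivAt_sinh t).mul hν.cosh).ofReal_comp
    have h2 := hν.sinh.ofReal_comp
    have h := ((hE.mul h1).const_mul (-z)).sub ((hE.mul h2).const_mul (ν : ℂ))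
    refine h.congr_deriv ?_
    have hsq : (Real.cosh t : ℂ) ^ 2 = (Real.sinh t : ℂ) ^ 2 + 1 := by
      exact_mod_cast Real.cosh_sq t
    simp only [F', B, Complex.ofReal_mul, Complex.ofReal_add, Complex.ofReal_pow]
    rw [hsq]
    simp only [Pi.mul_apply, Complex.ofReal_mul]
    ring
  have hF'int : IntegrableOn F' (Set.Ioi 0) :=
    (((hB 2).const_mul _).sub ((hB 1).const_mul _)).sub ((hB 0).const_mul _)
  have hFint : IntegrableOn F (Set.Ioi 0) := by
    refine ((integrableOn_exp_neg_mul_cosh_mul hz (by fun_prop) (1 + |ν|) fun t ht => ?_).const_mul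
      _).sub ((integrableOn_exp_neg_mul_cosh_mul hz (by fun_prop) |ν| fun t ht => ?_).const_mul _)
    · rw [abs_mul, add_mul, Real.exp_add, abs_of_pos (Real.cosh_pos (ν * t))]
      gcongr
      · simpa [abs_of_pos ht] using abs_sinh_le_exp_abs t
      · simpa [abs_mul, abs_of_pos ht] using cosh_le_exp_abs (ν * t)
    · simpa [abs_mul, abs_of_pos ht] using abs_sinh_le_exp_abs (ν * t)
  have h0 := integral_Ioi_of_hasDerivAt_of_tendsto' (fun t _ => hderiv t) hF'int
    (tendsto_zero_of_hasDerivAt_of_integrableOn_Ioi (fun t _ => hderiv t) hF'int hFint)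
  have hF0 : F 0 = 0 := by simp [F]
  have hsum : ∫ t in Set.Ioi (0 : ℝ), F' t = z ^ 2 * besselMoment ν 2 z - z * besselMoment ν 1 z
      - (ν ^ 2 + z ^ 2) * besselMoment ν 0 z := by
    have e1 := integral_sub (((hB 2).const_mul (z ^ 2)).sub ((hB 1).const_mul z))
      ((hB 0).const_mul ((ν : ℂ) ^ 2 + z ^ 2))
    have e2 := integral_sub ((hB 2).const_mul (z ^ 2)) ((hB 1).const_mul z)
    simp only [Pi.sub_apply] at e1
    rw [e2, integral_const_mul, integral_const_mul, integral_const_mul] at e1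
    exact e1
  rw [hF0, hsum] at h0
  linear_combination h0

/-- The Euclidean norm on `Fin 2 → ℝ`, as a complex number. -/
def radius (y : Fin 2 → ℝ) : ℂ := ((Real.sqrt ((y 0) ^ 2 + (y 1) ^ 2) : ℝ) : ℂ)

/-- The product `M_n(μ|y|) |y|^m (y₁ + i y₂)^k` with `M_n = besselMoment ν n`. -/
def radialHarmonic (ν : ℝ) (μ : ℂ) (n : ℕ) (m k : ℤ) (y : Fin 2 → ℝ) : ℂ :=
  besselMoment ν n (μ * radius y) * radius y ^ m * ((y 0 : ℂ) + Complex.I * (y 1 : ℂ)) ^ k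

theorem sq_add_sq_pos {y : Fin 2 → ℝ} (hy : y ≠ 0) : 0 < (y 0) ^ 2 + (y 1) ^ 2 := by
  by_contra! h
  apply hy
  have h0 : y 0 = 0 := by nlinarith [sq_nonneg (y 0), sq_nonneg (y 1)]
  have h1 : y 1 = 0 := by nlinarith [sq_nonneg (y 0), sq_nonneg (y 1)]
  ext i
  fin_cases i
  · exact h0
  · exact h1

theorem radius_sq (y : Fin 2 → ℝ) : radius y ^ 2 = (y 0 : ℂ) ^ 2 + (y 1 : ℂ) ^ 2 := by
  rw [radius, ← Complex.ofReal_pow, Real.sq_sqrt (by positivity)]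
  push_cast
  rfl

theorem radius_ne_zero {y : Fin 2 → ℝ} (hy : y ≠ 0) : radius y ≠ 0 :=
  Complex.ofReal_ne_zero.2 (Real.sqrt_pos.2 (sq_add_sq_pos hy)).ne'

theorem re_mul_radius_pos {μ : ℂ} (hμ : 0 < μ.re) {y : Fin 2 → ℝ} (hy : y ≠ 0) :
    0 < (μ * radius y).re := by
  rw [radius, Complex.re_mul_ofReal]
  exact mul_pos hμ (Real.sqrt_pos.2 (sq_add_sq_pos hy))

theorem add_I_mul_ne_zero {y : Fin 2 → ℝ} (hy : y ≠ 0) :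
    (y 0 : ℂ) + Complex.I * (y 1 : ℂ) ≠ 0 := by
  intro h
  have h2 : radius y ^ 2 = 0 := by
    rw [radius_sq]
    linear_combination ((y 0 : ℂ) - Complex.I * (y 1 : ℂ)) * h + (y 1 : ℂ) ^ 2 * Complex.I_sq
  exact radius_ne_zero hy (pow_eq_zero_iff two_ne_zero |>.1 h2)

/-- The coordinate functions, as continuous linear maps into `ℂ`. -/
def coordCLM (i : Fin 2) : (Fin 2 → ℝ) →L[ℝ] ℂ :=
  Complex.ofRealCLM.comp (ContinuousLinearMap.proj i)

@[simp] theorem coordCLM_apply (i : Fin 2) (y : Fin 2 → ℝ) : coordCLM i y = (y i : ℂ) := rfl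

theorem hasFDerivAt_coord (i : Fin 2) (y : Fin 2 → ℝ) :
    HasFDerivAt (fun y : Fin 2 → ℝ => (y i : ℂ)) (coordCLM i) y :=
  (coordCLM i).hasFDerivAt

theorem hasFDerivAt_radius {y : Fin 2 → ℝ} (hy : y ≠ 0) :
    HasFDerivAt radius ((radius y)⁻¹ • ((y 0 : ℂ) • coordCLM 0 + (y 1 : ℂ) • coordCLM 1)) y := by
  have hs := sq_add_sq_pos hy
  have hp : ∀ i : Fin 2, HasFDerivAt (fun y : Fin 2 → ℝ => y i)
      (ContinuousLinearMap.proj (R := ℝ) (φ := fun _ : Fin 2 => ℝ) i) y := fun i =>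
    (ContinuousLinearMap.proj (R := ℝ) (φ := fun _ : Fin 2 => ℝ) i).hasFDerivAt
  have h := Complex.ofRealCLM.hasFDerivAt.comp y
    ((((hp 0).pow 2).add ((hp 1).pow 2)).sqrt hs.ne')
  refine h.congr_fderiv ?_
  ext v
  simp [radius]
  ring

theorem hasFDerivAt_radialHarmonic (ν : ℝ) {μ : ℂ} (hμ : 0 < μ.re) (n : ℕ) (m k : ℤ)
    {y : Fin 2 → ℝ} (hy : y ≠ 0) :
    HasFDerivAt (radialHarmonic ν μ n m k)
      ((m * radialHarmonic ν μ n (m - 2) k y - μ * radialHarmonic ν μ (n + 1) (m - 1) k y) •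
          ((y 0 : ℂ) • coordCLM 0 + (y 1 : ℂ) • coordCLM 1) +
        (k * radialHarmonic ν μ n m (k - 1) y) • (coordCLM 0 + Complex.I • coordCLM 1)) y := by
  have hr := hasFDerivAt_radius hy
  have hr0 := radius_ne_zero hy
  have hw := (hasFDerivAt_coord 0 y).add ((hasFDerivAt_coord 1 y).const_mul Complex.I)
  have hJ := (hasDerivAt_besselMoment ν n (re_mul_radius_pos hμ hy)).comp_hasFDerivAt y
    (hr.const_mul μ)
  have hR := (hasDerivAt_zpow m (radius y) (.inl hr0)).comp_hasFDerivAt y hr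
  have hW := (hasDerivAt_zpow k _ (.inl (add_I_mul_ne_zero hy))).comp_hasFDerivAt y hw
  refine ((hJ.mul hR).mul hW).congr_fderiv ?_
  have e1 : radius y ^ (m - 1) = radius y ^ (m - 2) * radius y := by
    rw [← zpow_add_one₀ hr0]; congr 1; ring
  have e2 : radius y ^ m = radius y ^ (m - 2) * radius y ^ 2 := by
    rw [← zpow_natCast, ← zpow_add₀ hr0]; congr 1; push_cast; ring
  ext v
  simp [radialHarmonic, e1, e2]
  field_simp
  ring

theorem pd_zero_radialHarmonic (ν : ℝ) {μ : ℂ} (hμ : 0 < μ.re) (n : ℕ) (m k : ℤ)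
    {y : Fin 2 → ℝ} (hy : y ≠ 0) :
    pd 0 (radialHarmonic ν μ n m k) y =
      (y 0 : ℂ) * (m * radialHarmonic ν μ n (m - 2) k y -
        μ * radialHarmonic ν μ (n + 1) (m - 1) k y) + k * radialHarmonic ν μ n m (k - 1) y := by
  rw [pd, (hasFDerivAt_radialHarmonic ν hμ n m k hy).fderiv]
  simp
  ring

theorem pd_one_radialHarmonic (ν : ℝ) {μ : ℂ} (hμ : 0 < μ.re) (n : ℕ) (m k : ℤ)
    {y : Fin 2 → ℝ} (hy : y ≠ 0) :
    pd 1 (radialHarmonic ν μ n m k) y =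
      (y 1 : ℂ) * (m * radialHarmonic ν μ n (m - 2) k y -
        μ * radialHarmonic ν μ (n + 1) (m - 1) k y) +
        Complex.I * k * radialHarmonic ν μ n m (k - 1) y := by
  rw [pd, (hasFDerivAt_radialHarmonic ν hμ n m k hy).fderiv]
  simp
  ring

theorem pd_coord_mul_add {i : Fin 2} {f g h : (Fin 2 → ℝ) → ℂ} {x : Fin 2 → ℝ} (a b c : ℂ)
    (hf : DifferentiableAt ℝ f x) (hg : DifferentiableAt ℝ g x) (hh : DifferentiableAt ℝ h x) :
    pd i (fun y => (y i : ℂ) * (a * f y - b * g y) + c * h y) x =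
      a * f x - b * g x + (x i : ℂ) * (a * pd i f x - b * pd i g x) + c * pd i h x := by
  have h1 := ((hasFDerivAt_coord i x).mul ((hf.hasFDerivAt.const_mul a).sub
    (hg.hasFDerivAt.const_mul b))).add (hh.hasFDerivAt.const_mul c)
  have h2 : fderiv ℝ (fun y => (y i : ℂ) * (a * f y - b * g y) + c * h y) x = _ := h1.fderiv
  rw [pd, h2]
  simp [pd]
  ring

theorem pd_congr {i : Fin 2} {f g : (Fin 2 → ℝ) → ℂ} {x : Fin 2 → ℝ} (hx : x ≠ 0)
    (h : ∀ y, y ≠ 0 → f y = g y) : pd i f x = pd i g x := by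
  rw [pd, pd, Filter.EventuallyEq.fderiv_eq]
  filter_upwards [isOpen_ne.mem_nhds hx] with y hy using h y hy

/-- The defect functions of the Aharonov–Bohm operator: for `ν = |ℓ+α|` and `Re μ > 0`,
`G(x) = K_ν(μ|x|) u_ℓ(x)` satisfies `H_α G = -μ² G` on `ℝ² \ {0}`. In particular, for
`μ = e^{∓iπ/4}` one gets `H_α G = ±i G`, i.e. solutions of the deficiency equations. -/
theorem ab_defect_equation (α : ℝ) (ℓ : ℤ) (ν : ℝ) (hν : ν = |(ℓ : ℝ) + α|)
    (μ : ℂ) (hμ : 0 < μ.re) (x : Fin 2 → ℝ) (hx : x ≠ 0) :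
    ABop α (fun y => Kbessel ν (μ * (Real.sqrt ((y 0) ^ 2 + (y 1) ^ 2) : ℝ)) * uang ℓ y) x =
      -μ ^ 2 * (Kbessel ν (μ * (Real.sqrt ((x 0) ^ 2 + (x 1) ^ 2) : ℝ)) * uang ℓ x) := by
  have hψ : (fun y => Kbessel ν (μ * (Real.sqrt ((y 0) ^ 2 + (y 1) ^ 2) : ℝ)) * uang ℓ y) =
      radialHarmonic ν μ 0 (-ℓ) ℓ := by
    funext y
    rw [Kbessel_eq_besselMoment, uang, radialHarmonic, div_zpow, zpow_neg, radius]
    ring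
  have hψx : Kbessel ν (μ * (Real.sqrt ((x 0) ^ 2 + (x 1) ^ 2) : ℝ)) * uang ℓ x =
      radialHarmonic ν μ 0 (-ℓ) ℓ x := congrFun hψ x
  rw [hψ, hψx, ABop, pd_congr hx fun y hy => pd_zero_radialHarmonic ν hμ 0 (-ℓ) ℓ hy,
    pd_congr hx fun y hy => pd_one_radialHarmonic ν hμ 0 (-ℓ) ℓ hy]
  have hd : ∀ n m k, DifferentiableAt ℝ (radialHarmonic ν μ n m k) x := fun n m k =>
    (hasFDerivAt_radialHarmonic ν hμ n m k hx).differentiableAt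
  rw [pd_coord_mul_add _ _ _ (hd _ _ _) (hd _ _ _) (hd _ _ _),
    pd_coord_mul_add _ _ _ (hd _ _ _) (hd _ _ _) (hd _ _ _)]
  simp only [pd_zero_radialHarmonic ν hμ _ _ _ hx, pd_one_radialHarmonic ν hμ _ _ _ hx]
  have hr0 := radius_ne_zero hx
  have hw0 := add_I_mul_ne_zero hx
  have hr2 := radius_sq x
  have hode := sq_mul_besselMoment_two ν (re_mul_radius_pos hμ hx)
  have hν2 : (ν : ℂ) ^ 2 = ((ℓ : ℂ) + α) ^ 2 := by
    rw [hν, ← Complex.ofReal_pow, sq_abs]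
    push_cast
    rfl
  have hs : (((x 0) ^ 2 + (x 1) ^ 2 : ℝ) : ℂ) = radius x ^ 2 := by
    rw [hr2]; push_cast; rfl
  let T := fun n m k => radialHarmonic ν μ n m k x
  rw [Complex.ofReal_div, hs]
  linear_combination (norm := skip)
    (-(ℓ : ℂ) * (ℓ - 1) * T 0 (-ℓ) (ℓ - 2)
        - 2 * α / radius x ^ 2 * ℓ * T 0 (-ℓ) (ℓ - 1) * x 0) * Complex.I_sq
      + (-ℓ * ((-ℓ - 2) * T 0 (-ℓ - 4) ℓ - μ * T 1 (-ℓ - 3) ℓ)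
        - μ * ((-ℓ - 1) * T 1 (-ℓ - 3) ℓ - μ * T 2 (-ℓ - 2) ℓ)) * hr2
      - radius x ^ (-ℓ - 2) * ((x 0 : ℂ) + Complex.I * (x 1 : ℂ)) ^ ℓ * hode
      - T 0 (-ℓ - 2) ℓ * hν2
  have q1 : ∀ j : ℕ, radius x ^ (-ℓ - (j : ℤ)) = radius x ^ (-ℓ) / radius x ^ j := fun j => by
    rw [zpow_sub₀ hr0, zpow_natCast]
  have q2 : ∀ j : ℕ, ((x 0 : ℂ) + Complex.I * (x 1 : ℂ)) ^ (ℓ - (j : ℤ)) =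
      ((x 0 : ℂ) + Complex.I * (x 1 : ℂ)) ^ ℓ / ((x 0 : ℂ) + Complex.I * (x 1 : ℂ)) ^ j :=
    fun j => by rw [zpow_sub₀ hw0, zpow_natCast]
  have a1 := q1 1
  have a2 := q1 2
  have a3 := q1 3
  have a4 := q1 4
  have b1 := q2 1
  have b2 := q2 2
  push_cast at a1 a2 a3 a4 b1 b2
  have c1 : ℓ - 1 - 1 = ℓ - 2 := by ring
  have d1 : -ℓ - 1 - 1 = -ℓ - 2 := by ring
  have d2 : -ℓ - 1 - 2 = -ℓ - 3 := by ring
  have d3 : -ℓ - 2 - 1 = -ℓ - 3 := by ring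
  have d4 : -ℓ - 2 - 2 = -ℓ - 4 := by ring
  simp only [T, radialHarmonic, c1, d1, d2, d3, d4, a1, a2, a3, a4, b1, b2]
  generalize radius x ^ (-ℓ) = P
  generalize ((x 0 : ℂ) + Complex.I * (x 1 : ℂ)) ^ ℓ = W
  push_cast
  field_simp
  ring

end
end

section
/- Let ν ≥ 1 be a real number. Then ∫₀^∞ r·|K_ν(e^{-iπ/4} r)|² dr = +∞; that is, the function x ↦ K_ν(e^{-iπ/4}|x|) on ℝ² \ {0} is not square-integrable near the origin. (This is the reason why, for flux α ∈ (0,1), the deficiency solutions K_{|ℓ+α|}(e^{∓iπ/4}r)e^{iℓθ} fail to be in L²(ℝ²) for every angular momentum ℓ ∉ {0,-1}, where |ℓ+α| > 1.) -/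
open MeasureTheory
open scoped Real

noncomputable section

open Filter Topology

/-- The change of variables `x = e^τ` on the half-line. -/
theorem integral_Ioi_zero_eq_integral_exp_smul {E : Type*} [NormedAddCommGroup E]
    [NormedSpace ℝ E] (g : ℝ → E) :
    ∫ x in Set.Ioi (0 : ℝ), g x = ∫ τ : ℝ, Real.exp τ • g (Real.exp τ) := by
  have h := integral_image_eq_integral_abs_deriv_smul (f := Real.exp) (f' := Real.exp)
    MeasurableSet.univ (fun x _ => (Real.hasDerivAt_exp x).hasDerivWithinAt)
    Real.exp_injective.injOn g
  simpa [Set.image_univ, Real.range_exp, Real.abs_exp] using h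

theorem integral_exp_mul_exp_neg_mul_exp {ν c : ℝ} (hν : 0 < ν) (hc : 0 < c) :
    ∫ τ : ℝ, Real.exp (ν * τ) * Real.exp (-(c * Real.exp τ)) = (1 / c) ^ ν * Real.Gamma ν := by
  rw [← Real.integral_rpow_mul_exp_neg_mul_Ioi hν hc, integral_Ioi_zero_eq_integral_exp_smul]
  congr 1 with τ
  rw [smul_eq_mul, ← mul_assoc, ← Real.exp_mul, ← Real.exp_add τ]
  ring_nf

theorem integrable_exp_mul_exp_neg_mul_exp {ν c : ℝ} (hν : 0 < ν) (hc : 0 < c) :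
    Integrable fun τ : ℝ => Real.exp (ν * τ) * Real.exp (-(c * Real.exp τ)) := by
  refine Integrable.of_integral_ne_zero ?_
  rw [integral_exp_mul_exp_neg_mul_exp hν hc]
  have := Real.Gamma_pos_of_pos hν
  positivity

theorem analyticOnNhd_integral_cexp_mul_exp {ν : ℝ} (hν : 0 < ν) :
    AnalyticOnNhd ℂ
      (fun ζ : ℂ => ∫ τ : ℝ, Complex.exp (-(ζ * (Real.exp τ : ℂ))) * (Real.exp (ν * τ) : ℂ))
      {ζ : ℂ | 0 < ζ.re} := by
  let μ : Measure ℝ := volume.withDensity fun τ => ENNReal.ofReal (Real.exp (ν * τ))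
  let X : ℝ → ℝ := fun τ => -Real.exp τ
  have hmeas : Measurable fun τ : ℝ => ENNReal.ofReal (Real.exp (ν * τ)) := by fun_prop
  have hfin : ∀ᵐ τ : ℝ, ENNReal.ofReal (Real.exp (ν * τ)) < ⊤ :=
    ae_of_all _ fun _ => ENNReal.ofReal_lt_top
  have hset : Set.Ioi (0 : ℝ) ⊆ interior (ProbabilityTheory.integrableExpSet X μ) := by
    refine isOpen_Ioi.subset_interior_iff.2 fun c hc => ?_
    refine (integrable_withDensity_iff_integrable_smul' hmeas hfin).2 ?_
    simpa [X, ENNReal.toReal_ofReal (Real.exp_pos _).le] using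
      integrable_exp_mul_exp_neg_mul_exp hν hc
  have heq : (fun ζ : ℂ => ∫ τ : ℝ, Complex.exp (-(ζ * (Real.exp τ : ℂ))) *
      (Real.exp (ν * τ) : ℂ)) = ProbabilityTheory.complexMGF X μ := by
    ext ζ
    rw [ProbabilityTheory.complexMGF, integral_withDensity_eq_integral_toReal_smul hmeas hfin]
    congr 1 with τ
    rw [ENNReal.toReal_ofReal (Real.exp_pos _).le, Complex.real_smul, mul_comm, Complex.ofReal_neg,
      mul_neg]
  rw [heq]
  exact ProbabilityTheory.analyticOnNhd_complexMGF.mono fun ζ hζ => hset hζ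

/-- The Gamma integral `∫₀^∞ u^{ν-1} e^{-ζu} du`, in the variable `u = e^τ`, for complex `ζ`. -/
theorem integral_cexp_mul_exp {ν : ℝ} {ζ : ℂ} (hν : 0 < ν) (hζ : 0 < ζ.re) :
    ∫ τ : ℝ, Complex.exp (-(ζ * (Real.exp τ : ℂ))) * (Real.exp (ν * τ) : ℂ) =
      ζ ^ (-ν : ℂ) * (Real.Gamma ν : ℂ) := by
  have hright : AnalyticOnNhd ℂ (fun z : ℂ => z ^ (-ν : ℂ) * (Real.Gamma ν : ℂ))
      {z : ℂ | 0 < z.re} := fun z hz =>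
    (analyticAt_id.cpow analyticAt_const (Or.inl hz)).mul analyticAt_const
  refine (analyticOnNhd_integral_cexp_mul_exp hν).eqOn_of_preconnected_of_frequently_eq hright
    (convex_halfSpace_re_gt 0).isPreconnected (z₀ := ((1 : ℝ) : ℂ)) (by simp) ?_ hζ
  have hmap : Tendsto (fun x : ℝ => (x : ℂ)) (𝓝[≠] 1) (𝓝[≠] ((1 : ℝ) : ℂ)) :=
    Complex.continuous_ofReal.continuousWithinAt.tendsto_nhdsWithin fun x hx => by simpa using hx
  refine hmap.frequently (Eventually.frequently ?_)
  filter_upwards [nhdsWithin_le_nhds (lt_mem_nhds one_pos)] with c hc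
  have h := congrArg (fun x : ℝ => (x : ℂ)) (integral_exp_mul_exp_neg_mul_exp hν hc)
  rw [one_div, Real.inv_rpow hc.le, ← Real.rpow_neg hc.le] at h
  rw [← Complex.ofReal_neg, ← Complex.ofReal_cpow hc.le, ← Complex.ofReal_mul, ← h,
    ← integral_complex_ofReal]
  congr 1 with τ
  push_cast
  ring

theorem integral_cexp_mul_exp_ne_zero {ν : ℝ} {ζ : ℂ} (hν : 0 < ν) (hζ : 0 < ζ.re) :
    ∫ τ : ℝ, Complex.exp (-(ζ * (Real.exp τ : ℂ))) * (Real.exp (ν * τ) : ℂ) ≠ 0 := by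
  rw [integral_cexp_mul_exp hν hζ]
  have hζ0 : ζ ≠ 0 := fun h0 => by simp [h0] at hζ
  refine mul_ne_zero ?_ (by exact_mod_cast (Real.Gamma_pos_of_pos hν).ne')
  simp [Complex.cpow_eq_zero_iff, hζ0]

theorem exp_neg_mul_cosh_add (a τ s : ℝ) :
    Real.exp (-(a * s)) * Real.cosh (a * (τ + s)) =
      (Real.exp (a * τ) + Real.exp (-(a * τ)) * Real.exp (-(a * s)) ^ 2) / 2 := by
  rw [Real.cosh_eq, sq, mul_div_assoc', mul_add, ← Real.exp_add, ← Real.exp_add, ← Real.exp_add,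
    ← Real.exp_add]
  ring_nf

theorem tendsto_exp_neg_mul_cosh_add {a : ℝ} (ha : 0 < a) (τ : ℝ) :
    Tendsto (fun s : ℝ => Real.exp (-(a * s)) * Real.cosh (a * (τ + s))) atTop
      (𝓝 (Real.exp (a * τ) / 2)) := by
  simp only [exp_neg_mul_cosh_add]
  have h : Tendsto (fun s : ℝ => Real.exp (-(a * s))) atTop (𝓝 0) :=
    Real.tendsto_exp_neg_atTop_nhds_zero.comp (tendsto_id.const_mul_atTop ha)
  simpa using (((h.pow 2).const_mul (Real.exp (-(a * τ)))).const_add (Real.exp (a * τ))).div_const 2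

theorem exp_neg_mul_cosh_add_le {a τ s : ℝ} (ha : 0 < a) (h : 0 < τ + s) :
    Real.exp (-(a * s)) * Real.cosh (a * (τ + s)) ≤ Real.exp (a * τ) := by
  have hle : Real.exp (-(a * τ)) * Real.exp (-(a * s)) ^ 2 ≤ Real.exp (a * τ) := by
    rw [sq, ← Real.exp_add, ← Real.exp_add, Real.exp_le_exp]
    nlinarith [mul_pos ha h]
  rw [exp_neg_mul_cosh_add]
  linarith

theorem half_exp_le_exp_neg_mul_cosh_add (τ s : ℝ) :
    Real.exp τ / 2 ≤ Real.exp (-s) * Real.cosh (τ + s) := by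
  have h := exp_neg_mul_cosh_add 1 τ s
  simp only [one_mul] at h
  rw [h]
  have : 0 ≤ Real.exp (-τ) * Real.exp (-s) ^ 2 := by positivity
  linarith

theorem exp_neg_mul_Kbessel_eq (ν : ℝ) (ζ : ℂ) (s : ℝ) :
    (Real.exp (-(ν * s)) : ℂ) * Kbessel ν (ζ * (Real.exp (-s) : ℂ)) =
      ∫ τ : ℝ, (Set.Ioi (-s)).indicator (fun τ : ℝ =>
        Complex.exp (-(ζ * ((Real.exp (-s) * Real.cosh (τ + s) : ℝ) : ℂ))) *
          ((Real.exp (-(ν * s)) * Real.cosh (ν * (τ + s)) : ℝ) : ℂ)) τ := by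
  rw [Kbessel, ← integral_const_mul, ← integral_indicator measurableSet_Ioi,
    ← integral_add_right_eq_self _ s]
  congr 1 with τ
  by_cases h : 0 < τ + s
  · rw [Set.indicator_of_mem (Set.mem_Ioi.2 h),
      Set.indicator_of_mem (Set.mem_Ioi.2 (by linarith : -s < τ))]
    push_cast
    ring_nf
  · rw [Set.indicator_of_notMem (by simpa using h),
      Set.indicator_of_notMem (by rw [Set.mem_Ioi]; linarith)]

/-- The leading behaviour of `K_ν` at the origin along the ray through `ζ`:
`r^ν K_ν(ζ r)` converges as `r = e^{-s} → 0`. -/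
theorem tendsto_exp_neg_mul_Kbessel {ν : ℝ} {ζ : ℂ} (hν : 0 < ν) (hζ : 0 < ζ.re) :
    Tendsto (fun s : ℝ => (Real.exp (-(ν * s)) : ℂ) * Kbessel ν (ζ * (Real.exp (-s) : ℂ))) atTop
      (𝓝 (∫ τ : ℝ, Complex.exp (-(ζ * ((Real.exp τ / 2 : ℝ) : ℂ))) *
        ((Real.exp (ν * τ) / 2 : ℝ) : ℂ))) := by
  simp only [exp_neg_mul_Kbessel_eq]
  refine tendsto_integral_filter_of_dominated_convergence
    (fun τ => Real.exp (ν * τ) * Real.exp (-(ζ.re / 2 * Real.exp τ))) ?_ ?_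
    (integrable_exp_mul_exp_neg_mul_exp hν (half_pos hζ)) ?_
  · refine Eventually.of_forall fun s => ?_
    refine AEStronglyMeasurable.indicator (Continuous.aestronglyMeasurable ?_) measurableSet_Ioi
    fun_prop
  · refine Eventually.of_forall fun s => ae_of_all _ fun τ => ?_
    by_cases h : -s < τ
    · have hs : 0 < τ + s := by linarith
      have hpos : 0 ≤ Real.exp (-(ν * s)) * Real.cosh (ν * (τ + s)) := by positivity
      rw [Set.indicator_of_mem (Set.mem_Ioi.2 h), norm_mul, Complex.norm_exp,
        Complex.norm_of_nonneg hpos, mul_comm, Complex.neg_re, Complex.re_mul_ofReal]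
      gcongr ?_ * Real.exp (-?_)
      · exact exp_neg_mul_cosh_add_le hν hs
      · nlinarith [half_exp_le_exp_neg_mul_cosh_add τ s]
    · rw [Set.indicator_of_notMem (by simpa using h), norm_zero]
      positivity
  · refine ae_of_all _ fun τ => ?_
    have h1 := tendsto_exp_neg_mul_cosh_add one_pos τ
    simp only [one_mul] at h1
    have h2 := tendsto_exp_neg_mul_cosh_add hν τ
    have h3 := ((Complex.continuous_ofReal.tendsto _).comp h1).const_mul ζ
    refine Tendsto.congr' ?_ (((Complex.continuous_exp.tendsto _).comp h3.neg).mul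
      ((Complex.continuous_ofReal.tendsto _).comp h2))
    filter_upwards [eventually_gt_atTop (-τ)] with s hs
    rw [Set.indicator_of_mem (Set.mem_Ioi.2 (by linarith : -s < τ))]
    rfl

theorem exists_forall_le_rpow_mul_norm_Kbessel {ν : ℝ} {ζ : ℂ} (hν : 0 < ν) (hζ : 0 < ζ.re) :
    ∃ c > 0, ∃ δ > 0, ∀ r : ℝ, 0 < r → r < δ → c ≤ r ^ ν * ‖Kbessel ν (ζ * (r : ℂ))‖ := by
  have hlim := (tendsto_exp_neg_mul_Kbessel hν hζ).norm
  have hne : ∫ τ : ℝ, Complex.exp (-(ζ * ((Real.exp τ / 2 : ℝ) : ℂ))) *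
      ((Real.exp (ν * τ) / 2 : ℝ) : ℂ) ≠ 0 := by
    have h := integral_cexp_mul_exp_ne_zero (ζ := ζ / 2) hν (by simpa using hζ)
    refine fun h0 => h ?_
    have hfun : ∀ τ : ℝ, Complex.exp (-(ζ / 2 * (Real.exp τ : ℂ))) * (Real.exp (ν * τ) : ℂ) =
        2 * (Complex.exp (-(ζ * ((Real.exp τ / 2 : ℝ) : ℂ))) *
          ((Real.exp (ν * τ) / 2 : ℝ) : ℂ)) := fun τ => by
      push_cast
      ring_nf
    simp only [hfun]
    rw [integral_const_mul, h0, mul_zero]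
  obtain ⟨S, hS⟩ := eventually_atTop.1
    (hlim.eventually (lt_mem_nhds (half_lt_self (norm_pos_iff.2 hne))))
  refine ⟨_, half_pos (norm_pos_iff.2 hne), Real.exp (-S), Real.exp_pos _, fun r hr hrS => ?_⟩
  have hlog : S ≤ -Real.log r := by
    have := (Real.log_lt_iff_lt_exp hr).2 hrS
    linarith
  have h := (hS _ hlog).le
  rw [norm_mul, neg_neg, Real.exp_log hr, Complex.norm_of_nonneg (Real.exp_pos _).le,
    mul_neg, neg_neg, mul_comm ν, ← Real.rpow_def_of_pos hr] at h
  exact h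

theorem setLIntegral_ofReal_const_mul_inv_eq_top {c δ : ℝ} (hc : 0 < c) (hδ : 0 < δ) :
    ∫⁻ r in Set.Ioo 0 δ, ENNReal.ofReal (c * r⁻¹) = ⊤ := by
  by_contra h
  have hInt := (lintegral_ofReal_ne_top_iff_integrable (by fun_prop) ?_).1 h
  · have h' := (integrable_const_mul_iff (isUnit_iff_ne_zero.2 hc.ne') _).1 hInt
    have h'' := intervalIntegral.integrableOn_Ioo_rpow_iff (s := -1) hδ
    simp only [Real.rpow_neg_one, lt_irrefl, iff_false] at h''
    exact h'' h'
  · refine (ae_restrict_iff' measurableSet_Ioo).2 (ae_of_all _ fun r hr => ?_)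
    have := hr.1
    simp only [Pi.zero_apply]
    positivity

/-- For `ν ≥ 1`, `∫₀^∞ r |K_ν(e^{-iπ/4} r)|² dr = +∞`: the deficiency solution
`K_ν(e^{-iπ/4}|x|) e^{iℓθ}` fails to be square-integrable near the origin whenever
`ν = |ℓ+α| ≥ 1`, i.e. for every angular momentum `ℓ ∉ {0,-1}`. -/
theorem bessel_K_not_square_integrable (ν : ℝ) (hν : 1 ≤ ν) :
    ∫⁻ r in Set.Ioi (0 : ℝ),
        ENNReal.ofReal (r * ‖Kbessel ν (Complex.exp (-(π / 4 : ℝ) * Complex.I) * (r : ℂ))‖ ^ 2) =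
      ⊤ := by
  have hζ : 0 < (Complex.exp (-(π / 4 : ℝ) * Complex.I)).re := by
    rw [← Complex.ofReal_neg, Complex.exp_ofReal_mul_I_re, Real.cos_neg, Real.cos_pi_div_four]
    positivity
  obtain ⟨c, hc, δ, hδ, hbound⟩ := exists_forall_le_rpow_mul_norm_Kbessel
    (zero_lt_one.trans_le hν) hζ
  rw [eq_top_iff, ← setLIntegral_ofReal_const_mul_inv_eq_top (pow_pos hc 2)
    (lt_min hδ zero_lt_one)]
  refine (setLIntegral_mono' measurableSet_Ioo fun r hr => ENNReal.ofReal_le_ofReal ?_).trans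
    (lintegral_mono_set Set.Ioo_subset_Ioi_self)
  have hr0 : 0 < r := hr.1
  have hr1 : r < 1 := hr.2.trans_le (min_le_right _ _)
  set k := ‖Kbessel ν (Complex.exp (-(π / 4 : ℝ) * Complex.I) * (r : ℂ))‖
  have hk : c ≤ r * k := calc
    c ≤ r ^ ν * k := hbound r hr0 (hr.2.trans_le (min_le_left _ _))
    _ ≤ r * k := by
      gcongr
      simpa using Real.rpow_le_rpow_of_exponent_ge hr0 hr1.le hν
  calc c ^ 2 * r⁻¹ ≤ (r * k) ^ 2 * r⁻¹ := by gcongr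
    _ = r * k ^ 2 := by field_simp

end
end

section
/- Let ν ∈ (0,1) and μ > 0. Then lim_{r→0⁺} r^{-ν}·( ν·K_ν(μr) + r·(d/dr)[K_ν(μr)] ) = ν·Γ(-ν)·(μ/2)^ν. That is, in the combination (ν + r∂_r)K_ν(μr) the leading singular term Γ(ν)2^{ν-1}(μr)^{-ν} of K_ν cancels, and the limit is determined by the subleading term Γ(-ν)2^{-ν-1}(μr)^ν; equivalently, the trace functional τ applied to the defect function μ^ν K_ν(μr) yields -π μ^{2ν}/(2 sin(πν)) after multiplication by the normalization π 2^ν Γ(ν). -/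
open MeasureTheory
open scoped Real

noncomputable section

/-- The modified Bessel function of the second kind at real argument `x > 0`,
`K_ν(x) = ∫₀^∞ e^{-x cosh t} cosh(νt) dt`. -/
def KbesselR (ν x : ℝ) : ℝ :=
  ∫ t in Set.Ioi (0 : ℝ), Real.exp (-x * Real.cosh t) * Real.cosh (ν * t)

/-- The integrand of Euler's integral for `Γ(a)`, damped near `0`; the substitution
`u = (x / 2) e^t` turns it into the integrand of `K_a(x)`. -/
def dampedGammaIntegrand (a x u : ℝ) : ℝ :=
  Real.exp (-u) * u ^ (a - 1) * Real.exp (-(x ^ 2 / (4 * u)))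

lemma norm_dampedGammaIntegrand_le (a x : ℝ) {u : ℝ} (hu : 0 < u) :
    ‖dampedGammaIntegrand a x u‖ ≤ Real.exp (-u) * u ^ (a - 1) := by
  have h : 0 ≤ x ^ 2 / (4 * u) := by positivity
  rw [dampedGammaIntegrand, Real.norm_of_nonneg (by positivity)]
  exact mul_le_of_le_one_right (by positivity) (Real.exp_le_one_iff.2 (by linarith))

lemma measurable_dampedGammaIntegrand (a x : ℝ) : Measurable (dampedGammaIntegrand a x) := by
  unfold dampedGammaIntegrand
  fun_prop

lemma integrableOn_dampedGammaIntegrand {a : ℝ} (ha : 0 < a) (x : ℝ) :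
    IntegrableOn (dampedGammaIntegrand a x) (Set.Ioi 0) :=
  (Real.GammaIntegral_convergent ha).mono'
    (measurable_dampedGammaIntegrand a x).aestronglyMeasurable
    ((ae_restrict_mem measurableSet_Ioi).mono fun _ hu => norm_dampedGammaIntegrand_le a x hu)

lemma tendsto_integral_dampedGammaIntegrand {a : ℝ} (ha : 0 < a) :
    Filter.Tendsto (fun x => ∫ u in Set.Ioi (0 : ℝ), dampedGammaIntegrand a x u) (nhds 0)
      (nhds (Real.Gamma a)) := by
  rw [Real.Gamma_eq_integral ha]
  refine tendsto_integral_filter_of_dominated_convergence _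
    (.of_forall fun x => (measurable_dampedGammaIntegrand a x).aestronglyMeasurable)
    (.of_forall fun x => (ae_restrict_mem measurableSet_Ioi).mono
      fun _ hu => norm_dampedGammaIntegrand_le a x hu)
    (Real.GammaIntegral_convergent ha) (.of_forall fun u => ?_)
  have hc : Continuous fun x => dampedGammaIntegrand a x u := by
    unfold dampedGammaIntegrand
    fun_prop
  simpa [dampedGammaIntegrand] using hc.tendsto 0

lemma image_mul_exp_univ {c : ℝ} (hc : 0 < c) :
    (fun t => c * Real.exp t) '' Set.univ = Set.Ioi 0 := by
  ext u
  simp only [Set.image_univ, Set.mem_range, Set.mem_Ioi]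
  refine ⟨?_, fun hu => ⟨Real.log (u / c), ?_⟩⟩
  · rintro ⟨t, rfl⟩
    positivity
  · rw [Real.exp_log (by positivity)]
    field_simp

lemma injOn_mul_exp {c : ℝ} (hc : 0 < c) : Set.InjOn (fun t => c * Real.exp t) Set.univ :=
  fun _ _ _ _ h => Real.exp_injective (mul_left_cancel₀ hc.ne' h)

lemma hasDerivWithinAt_mul_exp (c : ℝ) (s : Set ℝ) (t : ℝ) :
    HasDerivWithinAt (fun t => c * Real.exp t) (c * Real.exp t) s t :=
  ((Real.hasDerivAt_exp t).const_mul c).hasDerivWithinAt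

lemma abs_smul_dampedGammaIntegrand (a : ℝ) {x : ℝ} (hx : 0 < x) (t : ℝ) :
    |x / 2 * Real.exp t| • dampedGammaIntegrand a x (x / 2 * Real.exp t) =
      (x / 2) ^ a * (Real.exp (-x * Real.cosh t) * Real.exp (a * t)) := by
  have hu : 0 < x / 2 * Real.exp t := by positivity
  have hpow : (x / 2 * Real.exp t) * (x / 2 * Real.exp t) ^ (a - 1) =
      (x / 2) ^ a * Real.exp (a * t) := by
    rw [Real.rpow_sub_one hu.ne', mul_div_cancel₀ _ hu.ne',
      Real.mul_rpow (by positivity) (by positivity), ← Real.exp_mul, mul_comm t]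
  have hexp : Real.exp (-(x / 2 * Real.exp t)) *
      Real.exp (-(x ^ 2 / (4 * (x / 2 * Real.exp t)))) = Real.exp (-x * Real.cosh t) := by
    rw [← Real.exp_add, Real.cosh_eq, Real.exp_neg t]
    congr 1
    field_simp
    ring
  rw [abs_of_pos hu, smul_eq_mul, dampedGammaIntegrand, ← hexp]
  linear_combination Real.exp (-(x / 2 * Real.exp t)) *
      Real.exp (-(x ^ 2 / (4 * (x / 2 * Real.exp t)))) * hpow

lemma integrable_exp_neg_mul_cosh_mul_exp {a x : ℝ} (ha : 0 < a) (hx : 0 < x) :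
    Integrable fun t => Real.exp (-x * Real.cosh t) * Real.exp (a * t) := by
  have h := (integrableOn_image_iff_integrableOn_abs_deriv_smul MeasurableSet.univ
    (fun t _ => hasDerivWithinAt_mul_exp (x / 2) Set.univ t) (injOn_mul_exp (half_pos hx))
    (dampedGammaIntegrand a x)).1
    (by rw [image_mul_exp_univ (half_pos hx)]; exact integrableOn_dampedGammaIntegrand ha x)
  simp only [abs_smul_dampedGammaIntegrand a hx, integrableOn_univ] at h
  exact (integrable_const_mul_iff
    (isUnit_iff_ne_zero.2 (Real.rpow_pos_of_pos (half_pos hx) a).ne') _).1 h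

lemma integral_exp_neg_mul_cosh_mul_exp (a : ℝ) {x : ℝ} (hx : 0 < x) :
    (x / 2) ^ a * ∫ t, Real.exp (-x * Real.cosh t) * Real.exp (a * t) =
      ∫ u in Set.Ioi (0 : ℝ), dampedGammaIntegrand a x u := by
  have h := integral_image_eq_integral_abs_deriv_smul MeasurableSet.univ
    (fun t _ => hasDerivWithinAt_mul_exp (x / 2) Set.univ t) (injOn_mul_exp (half_pos hx))
    (dampedGammaIntegrand a x)
  simp only [abs_smul_dampedGammaIntegrand a hx, image_mul_exp_univ (half_pos hx),
    Measure.restrict_univ, integral_const_mul] at h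
  exact h.symm

lemma integrable_exp_neg_mul_cosh_mul_exp_neg {a x : ℝ} (ha : 0 < a) (hx : 0 < x) :
    Integrable fun t => Real.exp (-x * Real.cosh t) * Real.exp (-(a * t)) := by
  simpa using (integrable_exp_neg_mul_cosh_mul_exp ha hx).comp_neg

lemma integrable_exp_neg_mul_cosh_mul_cosh {a x : ℝ} (ha : 0 < a) (hx : 0 < x) :
    Integrable fun t => Real.exp (-x * Real.cosh t) * Real.cosh (a * t) := by
  refine (((integrable_exp_neg_mul_cosh_mul_exp ha hx).add
    (integrable_exp_neg_mul_cosh_mul_exp_neg ha hx)).div_const 2).congr (.of_forall fun t => ?_)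
  simp only [Pi.add_apply, Real.cosh_eq (a * t)]
  ring

lemma integrable_exp_neg_mul_cosh_mul_sinh {a x : ℝ} (ha : 0 < a) (hx : 0 < x) :
    Integrable fun t => Real.exp (-x * Real.cosh t) * Real.sinh (a * t) := by
  refine (((integrable_exp_neg_mul_cosh_mul_exp ha hx).sub
    (integrable_exp_neg_mul_cosh_mul_exp_neg ha hx)).div_const 2).congr (.of_forall fun t => ?_)
  simp only [Pi.sub_apply, Real.sinh_eq (a * t)]
  ring

lemma integral_exp_neg_mul_cosh_mul_exp_eq_KbesselR {a x : ℝ} (ha : 0 < a) (hx : 0 < x) :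
    ∫ t, Real.exp (-x * Real.cosh t) * Real.exp (a * t) = 2 * KbesselR a x := by
  have hneg := integral_neg_eq_self
    (fun t => Real.exp (-x * Real.cosh t) * Real.exp (a * t)) volume
  have habs := integral_comp_abs
    (f := fun t => Real.exp (-x * Real.cosh t) * Real.cosh (a * t))
  have hcosh : ∫ t, Real.exp (-x * Real.cosh t) * Real.cosh (a * t) =
      ((∫ t, Real.exp (-x * Real.cosh t) * Real.exp (a * t)) +
        ∫ t, Real.exp (-x * Real.cosh t) * Real.exp (-(a * t))) / 2 := by
    rw [← integral_add (integrable_exp_neg_mul_cosh_mul_exp ha hx)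
      (integrable_exp_neg_mul_cosh_mul_exp_neg ha hx), ← integral_div]
    congr 1 with t
    rw [Real.cosh_eq (a * t)]
    ring
  have heven : ∀ t, Real.cosh (a * |t|) = Real.cosh (a * t) := fun t => by
    rw [← Real.cosh_abs (a * t), abs_mul, abs_of_pos ha]
  simp only [Real.cosh_abs, heven] at habs
  simp only [Real.cosh_neg, mul_neg] at hneg
  rw [KbesselR]
  linarith

/-- The leading behaviour `K_a(x) ~ Γ(a) / 2 * (x / 2) ^ (-a)` at `0`. -/
lemma tendsto_rpow_mul_KbesselR {a : ℝ} (ha : 0 < a) :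
    Filter.Tendsto (fun x => (x / 2) ^ a * (2 * KbesselR a x)) (nhdsWithin 0 (Set.Ioi 0))
      (nhds (Real.Gamma a)) := by
  refine ((tendsto_integral_dampedGammaIntegrand ha).mono_left nhdsWithin_le_nhds).congr' ?_
  filter_upwards [self_mem_nhdsWithin] with x hx
  rw [← integral_exp_neg_mul_cosh_mul_exp_eq_KbesselR ha hx,
    integral_exp_neg_mul_cosh_mul_exp a hx]

section

variable {ν x : ℝ}

lemma integrable_exp_neg_mul_cosh_mul_cosh_mul_cosh (hν : ν ∈ Set.Ioo (0 : ℝ) 1) (hx : 0 < x) :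
    Integrable fun t => Real.exp (-x * Real.cosh t) * (Real.cosh t * Real.cosh (ν * t)) := by
  refine (((integrable_exp_neg_mul_cosh_mul_cosh (a := 1 + ν) (by linarith [hν.1]) hx).add
    (integrable_exp_neg_mul_cosh_mul_cosh (sub_pos.2 hν.2) hx)).div_const 2).congr
    (.of_forall fun t => ?_)
  simp only [Pi.add_apply, add_mul, sub_mul, one_mul, Real.cosh_add, Real.cosh_sub]
  ring

lemma integrable_exp_neg_mul_cosh_mul_sinh_mul_sinh (hν : ν ∈ Set.Ioo (0 : ℝ) 1) (hx : 0 < x) :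
    Integrable fun t => Real.exp (-x * Real.cosh t) * (Real.sinh t * Real.sinh (ν * t)) := by
  refine (((integrable_exp_neg_mul_cosh_mul_cosh (a := 1 + ν) (by linarith [hν.1]) hx).sub
    (integrable_exp_neg_mul_cosh_mul_cosh (sub_pos.2 hν.2) hx)).div_const 2).congr
    (.of_forall fun t => ?_)
  simp only [Pi.sub_apply, add_mul, sub_mul, one_mul, Real.cosh_add, Real.cosh_sub]
  ring

lemma hasDerivAt_KbesselR (hν : ν ∈ Set.Ioo (0 : ℝ) 1) (hx : 0 < x) :
    HasDerivAt (KbesselR ν)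
      (-∫ t in Set.Ioi (0 : ℝ),
        Real.exp (-x * Real.cosh t) * (Real.cosh t * Real.cosh (ν * t))) x := by
  rw [← integral_neg]
  refine (hasDerivAt_integral_of_dominated_loc_of_deriv_le
    (F := fun x t => Real.exp (-x * Real.cosh t) * Real.cosh (ν * t))
    (F' := fun x t => -(Real.exp (-x * Real.cosh t) * (Real.cosh t * Real.cosh (ν * t))))
    (Ioi_mem_nhds (half_lt_self hx)) (.of_forall fun y => ?_)
    (integrable_exp_neg_mul_cosh_mul_cosh hν.1 hx).integrableOn ?_ (.of_forall fun t y hy => ?_)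
    (integrable_exp_neg_mul_cosh_mul_cosh_mul_cosh hν (half_pos hx)).integrableOn
    (.of_forall fun t y _ => ?_)).2
  · exact Continuous.aestronglyMeasurable (by fun_prop)
  · exact Continuous.aestronglyMeasurable (by fun_prop)
  · have hc := Real.cosh_pos t
    have hcν := Real.cosh_pos (ν * t)
    rw [norm_neg, Real.norm_of_nonneg (by positivity)]
    gcongr
    exact le_of_lt hy
  · have h := ((((hasDerivAt_id y).neg.mul_const (Real.cosh t)).exp).mul_const
      (Real.cosh (ν * t)))
    refine h.congr_deriv ?_
    simp only [id_eq, Pi.neg_apply]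
    ring

/-- Integration by parts in the definition of `K_ν`. -/
lemma mul_KbesselR_eq (hν : ν ∈ Set.Ioo (0 : ℝ) 1) (hx : 0 < x) :
    ν * KbesselR ν x = x * ∫ t in Set.Ioi (0 : ℝ),
      Real.exp (-x * Real.cosh t) * (Real.sinh t * Real.sinh (ν * t)) := by
  have hderiv : ∀ t, HasDerivAt (fun t => Real.exp (-x * Real.cosh t) * Real.sinh (ν * t))
      (ν * (Real.exp (-x * Real.cosh t) * Real.cosh (ν * t)) -
        x * (Real.exp (-x * Real.cosh t) * (Real.sinh t * Real.sinh (ν * t)))) t := fun t => by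
    have h := (((Real.hasDerivAt_cosh t).const_mul (-x)).exp).mul
      (((hasDerivAt_id t).const_mul ν).sinh)
    refine h.congr_deriv ?_
    simp only [id_eq]
    ring
  have hcosh := ((integrable_exp_neg_mul_cosh_mul_cosh hν.1 hx).const_mul ν).integrableOn
    (s := Set.Ioi 0)
  have hsinh := ((integrable_exp_neg_mul_cosh_mul_sinh_mul_sinh hν hx).const_mul x).integrableOn
    (s := Set.Ioi 0)
  have h := integral_Ioi_of_hasDerivAt_of_tendsto' (fun t _ => hderiv t) (hcosh.sub hsinh)
    (tendsto_zero_of_hasDerivAt_of_integrableOn_Ioi (fun t _ => hderiv t) (hcosh.sub hsinh)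
      (integrable_exp_neg_mul_cosh_mul_sinh hν.1 hx).integrableOn)
  rw [integral_sub hcosh hsinh, integral_const_mul, integral_const_mul] at h
  simp only [mul_zero, Real.sinh_zero, sub_zero] at h
  rw [KbesselR]
  linarith

/-- The recurrence `ν K_ν(x) + x K_ν'(x) = -x K_{1-ν}(x)`. -/
lemma mul_KbesselR_add_mul_deriv (hν : ν ∈ Set.Ioo (0 : ℝ) 1) (hx : 0 < x) :
    ν * KbesselR ν x + x * deriv (KbesselR ν) x = -(x * KbesselR (1 - ν) x) := by
  have h : KbesselR (1 - ν) x =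
      (∫ t in Set.Ioi (0 : ℝ),
        Real.exp (-x * Real.cosh t) * (Real.cosh t * Real.cosh (ν * t))) -
      ∫ t in Set.Ioi (0 : ℝ),
        Real.exp (-x * Real.cosh t) * (Real.sinh t * Real.sinh (ν * t)) := by
    rw [KbesselR, ← integral_sub
      (integrable_exp_neg_mul_cosh_mul_cosh_mul_cosh hν hx).integrableOn
      (integrable_exp_neg_mul_cosh_mul_sinh_mul_sinh hν hx).integrableOn]
    congr 1 with t
    rw [sub_mul, one_mul, Real.cosh_sub]
    ring
  rw [(hasDerivAt_KbesselR hν hx).deriv, mul_KbesselR_eq hν hx, h]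
  ring

end

/-- For `ν ∈ (0,1)` and `μ > 0`, the leading singularity cancels in
`(ν + r ∂_r) K_ν(μr)` and
`lim_{r→0⁺} r^{-ν} (ν K_ν(μr) + r (d/dr)[K_ν(μr)]) = ν Γ(-ν) (μ/2)^ν`. -/
theorem bessel_K_trace_limit (ν : ℝ) (hν : ν ∈ Set.Ioo (0 : ℝ) 1) (μ : ℝ) (hμ : 0 < μ) :
    Filter.Tendsto
      (fun r : ℝ => r ^ (-ν) *
        (ν * KbesselR ν (μ * r) + r * deriv (fun s : ℝ => KbesselR ν (μ * s)) r))
      (nhdsWithin 0 (Set.Ioi 0))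
      (nhds (ν * Real.Gamma (-ν) * (μ / 2) ^ ν)) := by
  have hlim : Filter.Tendsto (fun r : ℝ => μ * r) (nhdsWithin 0 (Set.Ioi 0))
      (nhdsWithin 0 (Set.Ioi 0)) := by
    refine tendsto_nhdsWithin_iff.2 ⟨?_, ?_⟩
    · have hc : Continuous fun r : ℝ => μ * r := by fun_prop
      simpa using (hc.tendsto 0).mono_left nhdsWithin_le_nhds
    · filter_upwards [self_mem_nhdsWithin] with r hr using mul_pos hμ hr
  have hmain := ((tendsto_rpow_mul_KbesselR (sub_pos.2 hν.2)).comp hlim).const_mul (-(μ / 2) ^ ν)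
  have hΓ : Real.Gamma (1 - ν) = -ν * Real.Gamma (-ν) := by
    rw [← Real.Gamma_add_one (neg_ne_zero.2 hν.1.ne'), neg_add_eq_sub]
  have hval : ν * Real.Gamma (-ν) * (μ / 2) ^ ν = -(μ / 2) ^ ν * Real.Gamma (1 - ν) := by
    rw [hΓ]
    ring
  rw [hval]
  refine hmain.congr' ?_
  filter_upwards [self_mem_nhdsWithin] with r (hr : 0 < r)
  have hrec := mul_KbesselR_add_mul_deriv hν (mul_pos hμ hr)
  have hpow : (μ / 2) ^ ν * (μ * r / 2) ^ (1 - ν) = r ^ (-ν) * (μ * r / 2) := by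
    rw [mul_div_right_comm, Real.mul_rpow (half_pos hμ).le hr.le, ← mul_assoc,
      ← Real.rpow_add (half_pos hμ), add_sub_cancel, Real.rpow_one, sub_eq_neg_add,
      Real.rpow_add hr, Real.rpow_one]
    ring
  rw [deriv_comp_mul_left μ (KbesselR ν), smul_eq_mul, Function.comp_apply]
  linear_combination (-2 * KbesselR (1 - ν) (μ * r)) * hpow - r ^ (-ν) * hrec

end
end

section
/- Let α ∈ (0,1) and let g : ℝ → ℂ be a smooth 2π-periodic function with Fourier coefficients ĝ(ℓ) := (1/2π)∫_{-π}^{π} e^{-iℓω} g(ω) dω for ℓ ∈ ℤ. Then the series Σ_{ℓ∈ℤ} e^{iπ(|ℓ| - |ℓ+α|)}·ĝ(ℓ) converges absolutely, the principal value limit lim_{ε→0⁺} ∫_{ε≤|ω|≤π} g(ω)/(e^{-iω} - 1) dω exists, and Σ_{ℓ∈ℤ} e^{iπ(|ℓ| - |ℓ+α|)}·ĝ(ℓ) = cos(πα)·g(0) + (i/π)·sin(πα)·lim_{ε→0⁺} ∫_{ε≤|ω|≤π} g(ω)/(e^{-iω} - 1) dω. This identity expresses the (energy-independent) scattering matrix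 of the Friedrichs Aharonov–Bohm Hamiltonian: its integral kernel is S^{(F)}(ω,ω') = cos(πα)·δ(ω-ω') + (i/π)·sin(πα)·P.V.(1/(e^{i(ω-ω')} - 1)), with phase shifts δ_ℓ = (π/2)(|ℓ| - |ℓ+α|). -/
open MeasureTheory
open scoped Real

noncomputable section

/-- The `ℓ`-th Fourier coefficient of a `2π`-periodic function,
`ĝ(ℓ) = (1/2π) ∫_{-π}^{π} e^{-iℓω} g(ω) dω`. -/
def fourierCoeffPer (g : ℝ → ℂ) (ℓ : ℤ) : ℂ :=
  ((1 / (2 * π) : ℝ) : ℂ) *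
    ∫ ω in (-π : ℝ)..π, Complex.exp (-Complex.I * (ℓ : ℂ) * (ω : ℂ)) * g ω

/-- The trivial bound on Fourier coefficients, uniform in the index. -/
lemma exists_norm_fourierCoeffPer_le {g : ℝ → ℂ} (hg : Continuous g) :
    ∃ C : ℝ, ∀ ℓ : ℤ, ‖fourierCoeffPer g ℓ‖ ≤ C := by
  obtain ⟨C, hC⟩ := (isCompact_uIcc (a := -π) (b := π)).exists_bound_of_continuousOn hg.continuousOn
  refine ⟨‖((1 / (2 * π) : ℝ) : ℂ)‖ * (C * |π - -π|), fun ℓ => ?_⟩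
  rw [fourierCoeffPer, norm_mul]
  refine mul_le_mul_of_nonneg_left ?_ (norm_nonneg _)
  refine intervalIntegral.norm_integral_le_of_norm_le_const fun x hx => ?_
  have hexp : ‖Complex.exp (-Complex.I * (ℓ : ℂ) * (x : ℂ))‖ = 1 := by
    rw [Complex.norm_exp]; simp
  rw [norm_mul, hexp, one_mul]
  exact hC x (Set.uIoc_subset_uIcc hx)

lemma exp_neg_I_mul_int_mul_pi (ℓ : ℤ) :
    Complex.exp (-Complex.I * (ℓ : ℂ) * ((-π : ℝ) : ℂ)) =
      Complex.exp (-Complex.I * (ℓ : ℂ) * ((π : ℝ) : ℂ)) := by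
  rw [Complex.exp_eq_exp_iff_exists_int]
  exact ⟨ℓ, by push_cast; ring⟩

lemma hasDerivAt_exp_mul_ofReal (c : ℂ) (x : ℝ) :
    HasDerivAt (fun ω : ℝ => Complex.exp (c * (ω : ℂ))) (c * Complex.exp (c * (x : ℂ))) x := by
  simpa [mul_comm] using (((hasDerivAt_id (x : ℂ)).const_mul c).cexp).comp_ofReal

/-- Integration by parts: the Fourier coefficients of the derivative. -/
lemma fourierCoeffPer_deriv {g : ℝ → ℂ} (hg : ContDiff ℝ 1 g)
    (hper : Function.Periodic g (2 * π)) (ℓ : ℤ) :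
    fourierCoeffPer (deriv g) ℓ = Complex.I * (ℓ : ℂ) * fourierCoeffPer g ℓ := by
  have hparts := intervalIntegral.integral_mul_deriv_eq_deriv_mul (a := -π) (b := π)
    (fun x _ => hasDerivAt_exp_mul_ofReal (-Complex.I * (ℓ : ℂ)) x)
    (fun x _ => (hg.differentiable one_ne_zero x).hasDerivAt)
    (Continuous.intervalIntegrable (by fun_prop) _ _)
    ((hg.continuous_deriv le_rfl).intervalIntegrable _ _)
  have hends : g π = g (-π) := by
    rw [← hper (-π)]; congr 1; ring
  have hmul : ∀ x : ℝ, -Complex.I * (ℓ : ℂ) * Complex.exp (-Complex.I * (ℓ : ℂ) * (x : ℂ)) * g x =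
      -Complex.I * (ℓ : ℂ) * (Complex.exp (-Complex.I * (ℓ : ℂ) * (x : ℂ)) * g x) :=
    fun x => by ring
  simp only [hmul, intervalIntegral.integral_const_mul] at hparts
  rw [exp_neg_I_mul_int_mul_pi, hends, sub_self, zero_sub] at hparts
  rw [fourierCoeffPer, fourierCoeffPer, hparts]
  ring

lemma periodic_deriv {g : ℝ → ℂ} {c : ℝ} (hper : Function.Periodic g c) :
    Function.Periodic (deriv g) c := fun x => by
  rw [← deriv_comp_add_const]
  congr 1
  exact funext hper

/-- The Fourier coefficients of a periodic `C²` function are absolutely summable. -/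
lemma summable_norm_fourierCoeffPer {g : ℝ → ℂ} (hg : ContDiff ℝ 2 g)
    (hper : Function.Periodic g (2 * π)) :
    Summable fun ℓ : ℤ => ‖fourierCoeffPer g ℓ‖ := by
  have hg' : ContDiff ℝ 1 (deriv g) := by
    have h : ContDiff ℝ (1 + 1) g := by simpa [one_add_one_eq_two] using hg
    exact (contDiff_succ_iff_deriv.1 h).2.2
  obtain ⟨C, hC⟩ := exists_norm_fourierCoeffPer_le (hg'.continuous_deriv le_rfl)
  have hsum : Summable fun ℓ : ℤ => C * (1 / (ℓ : ℝ) ^ 2) :=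
    (Real.summable_one_div_int_pow.2 one_lt_two).mul_left C
  refine Summable.of_norm_bounded_eventually hsum ?_
  filter_upwards [(Set.finite_singleton (0 : ℤ)).compl_mem_cofinite] with ℓ hℓ
  have hℓ0 : (ℓ : ℝ) ≠ 0 := by exact_mod_cast hℓ
  have hℓC := hC ℓ
  rw [fourierCoeffPer_deriv hg' (periodic_deriv hper),
    fourierCoeffPer_deriv (hg.of_le one_le_two) hper] at hℓC
  simp only [norm_mul, Complex.norm_I, one_mul, Complex.norm_intCast] at hℓC
  rw [norm_norm, mul_one_div, le_div_iff₀ (by positivity), ← sq_abs]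
  linarith

/-- The Riemann–Lebesgue lemma for Fourier coefficients. -/
lemma tendsto_fourierCoeffPer_cofinite (k : ℝ → ℂ) :
    Filter.Tendsto (fourierCoeffPer k) Filter.cofinite (nhds 0) := by
  have hint : ∀ ℓ : ℤ, ∫ v : ℝ, Real.fourierChar (-(v * ((ℓ : ℝ) / (2 * π)))) •
      (Set.Ioc (-π) π).indicator k v =
      ∫ ω in (-π : ℝ)..π, Complex.exp (-Complex.I * (ℓ : ℂ) * (ω : ℂ)) * k ω := by
    intro ℓ
    rw [intervalIntegral.integral_of_le (by linarith [Real.pi_pos]),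
      ← integral_indicator measurableSet_Ioc]
    refine integral_congr_ae (Filter.Eventually.of_forall fun v => ?_)
    by_cases hv : v ∈ Set.Ioc (-π) π
    · simp only [Set.indicator_of_mem hv, Circle.smul_def, Real.fourierChar_apply, smul_eq_mul]
      congr 2
      have : (π : ℂ) ≠ 0 := by exact_mod_cast Real.pi_ne_zero
      push_cast
      field_simp
    · simp [Set.indicator_of_notMem hv]
  have hcoe : Filter.Tendsto (fun ℓ : ℤ => (ℓ : ℝ) / (2 * π)) Filter.cofinite
      (Filter.cocompact ℝ) := by
    simp only [div_eq_mul_inv]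
    exact (Filter.tendsto_cocompact_mul_right₀ (by positivity)).comp
      (Filter.cocompact_eq_cofinite ℤ ▸ Int.isClosedEmbedding_coe_real.tendsto_cocompact)
  have h := ((Real.tendsto_integral_exp_smul_cocompact
    ((Set.Ioc (-π) π).indicator k)).comp hcoe).const_mul ((1 / (2 * π) : ℝ) : ℂ)
  simp only [Function.comp_def, hint, mul_zero] at h
  exact h

lemma fourierCoeffPer_const (c : ℂ) (ℓ : ℤ) :
    fourierCoeffPer (fun _ => c) ℓ = if ℓ = 0 then c else 0 := by
  have hpi : (π : ℂ) ≠ 0 := by exact_mod_cast Real.pi_ne_zero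
  rw [fourierCoeffPer, intervalIntegral.integral_mul_const]
  split_ifs with h
  · subst h
    simp
    field_simp
    norm_num
  · have hc : -Complex.I * (ℓ : ℂ) ≠ 0 := by simp [h]
    rw [integral_exp_mul_complex hc, exp_neg_I_mul_int_mul_pi]
    simp

/-- If `g - c = (e^{-iω} - 1) k` then the Fourier coefficients of `g`, up to the constant mode,
are differences of those of `k`. -/
lemma fourierCoeffPer_eq_sub {g k : ℝ → ℂ} {c : ℂ}
    (hk : IntervalIntegrable k volume (-π) π)
    (h : ∀ ω ∈ Set.uIcc (-π) π, g ω = c + (Complex.exp (-Complex.I * (ω : ℂ)) - 1) * k ω)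
    (ℓ : ℤ) :
    fourierCoeffPer g ℓ =
      (if ℓ = 0 then c else 0) + (fourierCoeffPer k (ℓ + 1) - fourierCoeffPer k ℓ) := by
  rw [← fourierCoeffPer_const]
  simp only [fourierCoeffPer]
  rw [← mul_sub, ← mul_add, ← intervalIntegral.integral_sub, ← intervalIntegral.integral_add]
  · congr 1
    refine intervalIntegral.integral_congr fun ω hω => ?_
    have hexp : Complex.exp (-Complex.I * ((ℓ + 1 : ℤ) : ℂ) * (ω : ℂ)) =
        Complex.exp (-Complex.I * (ℓ : ℂ) * (ω : ℂ)) * Complex.exp (-Complex.I * (ω : ℂ)) := by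
      rw [← Complex.exp_add]; congr 1; push_cast; ring
    simp only [h ω hω, hexp]
    ring
  · exact Continuous.intervalIntegrable (by fun_prop) _ _
  · exact (hk.continuousOn_mul (by fun_prop)).sub (hk.continuousOn_mul (by fun_prop))
  · exact hk.continuousOn_mul (by fun_prop)
  · exact hk.continuousOn_mul (by fun_prop)

lemma exp_neg_I_mul_ofReal_ne_one {ω : ℝ} (h0 : ω ≠ 0) (hω : |ω| ≤ π) :
    Complex.exp (-Complex.I * (ω : ℂ)) - 1 ≠ 0 := by
  rw [sub_ne_zero, Ne, Complex.exp_eq_one_iff]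
  rintro ⟨n, hn⟩
  have him := congrArg Complex.im hn
  simp at him
  have hn0 : n ≠ 0 := by rintro rfl; simp at him; exact h0 him
  have h1 : (1 : ℝ) ≤ |(n : ℝ)| := by exact_mod_cast Int.one_le_abs hn0
  have h2 : |ω| = |(n : ℝ)| * (2 * π) := by
    rw [← abs_neg, him, abs_mul, abs_of_pos (by positivity : (0 : ℝ) < 2 * π)]
  nlinarith [Real.pi_pos]

/-- The removable singularity at `0`: `(g - g 0) / (e^{-iω} - 1)` extends continuously. -/
lemma exists_continuousOn_quotient {g : ℝ → ℂ} (hg : ContDiff ℝ 1 g) :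
    ∃ k : ℝ → ℂ, ContinuousOn k (Set.uIcc (-π) π) ∧
      ∀ ω ∈ Set.uIcc (-π) π,
        g ω = g 0 + (Complex.exp (-Complex.I * (ω : ℂ)) - 1) * k ω := by
  set E : ℝ → ℂ := fun ω => Complex.exp (-Complex.I * (ω : ℂ)) with hE
  have hE0 : E 0 = 1 := by simp [hE]
  have hcont : ∀ f : ℝ → ℂ, Differentiable ℝ f → Continuous (dslope f 0) := fun f hf => by
    rw [← continuousOn_univ, continuousOn_dslope Filter.univ_mem]
    exact ⟨hf.continuous.continuousOn, hf 0⟩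
  have hne : ∀ ω ∈ Set.uIcc (-π) π, dslope E 0 ω ≠ 0 := by
    intro ω hω
    rw [Set.uIcc_of_le (by linarith [Real.pi_pos])] at hω
    rcases eq_or_ne ω 0 with rfl | h0
    · rw [dslope_same, (hasDerivAt_exp_mul_ofReal (-Complex.I) 0).deriv]
      simp
    · intro hz
      have h := sub_smul_dslope E 0 ω
      rw [hz, smul_zero, hE0] at h
      exact exp_neg_I_mul_ofReal_ne_one h0 (abs_le.2 hω) h.symm
  refine ⟨fun ω => dslope g 0 ω / dslope E 0 ω, ?_, fun ω hω => ?_⟩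
  · exact (hcont g (hg.differentiable one_ne_zero)).continuousOn.div
      (hcont E fun x => (hasDerivAt_exp_mul_ofReal _ x).differentiableAt).continuousOn hne
  · have h1 := sub_smul_dslope g 0 ω
    have h2 := sub_smul_dslope E 0 ω
    rw [hE0] at h2
    have h3 := hne ω hω
    change g ω = g 0 + (E ω - 1) * _
    rw [← h2, smul_mul_assoc, mul_div_cancel₀ _ h3, h1]
    ring

lemma setOf_le_abs_eq_union {ε : ℝ} (hε : 0 < ε) :
    {ω : ℝ | ε ≤ |ω| ∧ |ω| ≤ π} = Set.Icc (-π) (-ε) ∪ Set.Icc ε π := by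
  ext ω
  simp only [Set.mem_ofPred_eq, Set.mem_union, Set.mem_Icc, le_abs, abs_le]
  constructor
  · rintro ⟨h | h, h1, h2⟩
    · exact Or.inr ⟨h, h2⟩
    · exact Or.inl ⟨h1, by linarith⟩
  · rintro (⟨h1, h2⟩ | ⟨h1, h2⟩)
    · exact ⟨Or.inr (by linarith), h1, by linarith [Real.pi_pos]⟩
    · exact ⟨Or.inl h1, by linarith, h2⟩

/-- Integration over a symmetric annulus, with reflection of the negative half. -/
lemma setIntegral_annulus_eq {f : ℝ → ℂ} {ε : ℝ} (hε : 0 < ε) (hεπ : ε ≤ π)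
    (hf : ContinuousOn f {ω : ℝ | ε ≤ |ω| ∧ |ω| ≤ π}) :
    ∫ ω in {ω : ℝ | ε ≤ |ω| ∧ |ω| ≤ π}, f ω =
      (∫ ω in (-π)..(-ε), f ω) + ∫ ω in ε..π, f ω := by
  rw [setOf_le_abs_eq_union hε] at hf ⊢
  rw [setIntegral_union _ measurableSet_Icc
      (hf.mono Set.subset_union_left).integrableOn_Icc
      (hf.mono Set.subset_union_right).integrableOn_Icc,
    integral_Icc_eq_integral_Ioc, integral_Icc_eq_integral_Ioc,
    intervalIntegral.integral_of_le (by linarith), intervalIntegral.integral_of_le hεπ]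
  refine Set.disjoint_left.2 fun x hx hx' => ?_
  linarith [hx.2, hx'.1]

/-- The symmetric truncations of the constant-mode integral: only the real part survives. -/
lemma setIntegral_annulus_inv_exp_sub_one {ε : ℝ} (hε : 0 < ε) (hεπ : ε ≤ π) :
    ∫ ω in {ω : ℝ | ε ≤ |ω| ∧ |ω| ≤ π}, (Complex.exp (-Complex.I * (ω : ℂ)) - 1)⁻¹ =
      -((π - ε : ℝ) : ℂ) := by
  have hcont : ContinuousOn (fun ω : ℝ => (Complex.exp (-Complex.I * (ω : ℂ)) - 1)⁻¹)
      {ω : ℝ | ε ≤ |ω| ∧ |ω| ≤ π} := by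
    refine ContinuousOn.inv₀ (by fun_prop) fun ω hω => ?_
    exact exp_neg_I_mul_ofReal_ne_one (abs_pos.1 (hε.trans_le hω.1)) hω.2
  rw [setIntegral_annulus_eq hε hεπ hcont]
  have hsub : Set.uIcc ε π ⊆ {ω : ℝ | ε ≤ |ω| ∧ |ω| ≤ π} := by
    rw [setOf_le_abs_eq_union hε, Set.uIcc_of_le hεπ]
    exact Set.subset_union_right
  have hneg : ContinuousOn (fun ω : ℝ => (Complex.exp (-Complex.I * ((-ω : ℝ) : ℂ)) - 1)⁻¹)
      (Set.uIcc ε π) :=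
    hcont.comp (by fun_prop) fun ω hω => by simpa using hsub hω
  rw [← intervalIntegral.integral_comp_neg
      (fun ω : ℝ => (Complex.exp (-Complex.I * (ω : ℂ)) - 1)⁻¹),
    ← intervalIntegral.integral_add hneg.intervalIntegrable
      (hcont.mono hsub).intervalIntegrable]
  rw [intervalIntegral.integral_congr (g := fun _ => (-1 : ℂ))]
  · simp
  · intro ω hω
    have hω' := hsub hω
    have h1 := exp_neg_I_mul_ofReal_ne_one (abs_pos.1 (hε.trans_le hω'.1)) hω'.2
    have h2 : Complex.exp (-Complex.I * ((-ω : ℝ) : ℂ)) =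
        (Complex.exp (-Complex.I * (ω : ℂ)))⁻¹ := by
      rw [← Complex.exp_neg]; congr 1; push_cast; ring
    have h3 := Complex.exp_ne_zero (-Complex.I * (ω : ℂ))
    simp only [h2]
    generalize Complex.exp (-Complex.I * (ω : ℂ)) = z at *
    have h4 : (z⁻¹ - 1)⁻¹ = -z * (z - 1)⁻¹ := by
      rw [show z⁻¹ - 1 = -z⁻¹ * (z - 1) by field_simp; ring, mul_inv, inv_neg, inv_inv]
    rw [h4]
    field_simp
    ring

/-- Symmetric truncations of the integral of a continuous function converge. -/
lemma tendsto_setIntegral_annulus {k : ℝ → ℂ} (hk : ContinuousOn k (Set.uIcc (-π) π)) :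
    Filter.Tendsto (fun ε : ℝ => ∫ ω in {ω : ℝ | ε ≤ |ω| ∧ |ω| ≤ π}, k ω)
      (nhdsWithin 0 (Set.Ioi 0)) (nhds (∫ ω in (-π)..π, k ω)) := by
  obtain ⟨C, hC⟩ := isCompact_uIcc.exists_bound_of_continuousOn hk
  have hpi := Real.pi_pos
  have huIcc : Set.uIcc (-π) π = Set.Icc (-π) π := Set.uIcc_of_le (by linarith)
  have hlim : Filter.Tendsto (fun ε : ℝ => C * |ε - -ε|) (nhdsWithin 0 (Set.Ioi 0)) (nhds 0) := by
    refine tendsto_nhdsWithin_of_tendsto_nhds ?_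
    have : Continuous fun ε : ℝ => C * |ε - -ε| := by fun_prop
    simpa using this.tendsto 0
  rw [tendsto_iff_norm_sub_tendsto_zero]
  refine squeeze_zero' (Filter.Eventually.of_forall fun _ => norm_nonneg _) ?_ hlim
  filter_upwards [Ioc_mem_nhdsGT hpi] with ε hε
  have hint : ∀ {a b : ℝ}, a ∈ Set.Icc (-π) π → b ∈ Set.Icc (-π) π →
      IntervalIntegrable k volume a b := fun ha hb =>
    (hk.mono (by rw [huIcc]; exact Set.uIcc_subset_Icc ha hb)).intervalIntegrable
  have m1 : -π ∈ Set.Icc (-π) π := ⟨le_rfl, by linarith⟩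
  have m2 : -ε ∈ Set.Icc (-π) π := ⟨by linarith [hε.2], by linarith [hε.1]⟩
  have m3 : ε ∈ Set.Icc (-π) π := ⟨by linarith [hε.1], hε.2⟩
  have m4 : π ∈ Set.Icc (-π) π := ⟨by linarith, le_rfl⟩
  rw [setIntegral_annulus_eq hε.1 hε.2 (hk.mono fun ω hω => huIcc ▸ abs_le.1 hω.2),
    ← intervalIntegral.integral_add_adjacent_intervals (hint m1 m2) (hint m2 m4),
    ← intervalIntegral.integral_add_adjacent_intervals (hint m2 m3) (hint m3 m4),
    show ∀ a b c : ℂ, a + c - (a + (b + c)) = -b from fun a b c => by ring, norm_neg]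
  exact intervalIntegral.norm_integral_le_of_norm_le_const fun x hx =>
    hC x (huIcc ▸ Set.uIcc_subset_Icc m2 m3 (Set.uIoc_subset_uIcc hx))

/-- The principal value integral against `1 / (e^{-iω} - 1)`. -/
lemma tendsto_setIntegral_annulus_div {g k : ℝ → ℂ} {c : ℂ}
    (hk : ContinuousOn k (Set.uIcc (-π) π))
    (h : ∀ ω ∈ Set.uIcc (-π) π, g ω = c + (Complex.exp (-Complex.I * (ω : ℂ)) - 1) * k ω) :
    Filter.Tendsto
      (fun ε : ℝ => ∫ ω in {ω : ℝ | ε ≤ |ω| ∧ |ω| ≤ π},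
        g ω / (Complex.exp (-Complex.I * (ω : ℂ)) - 1))
      (nhdsWithin 0 (Set.Ioi 0)) (nhds ((∫ ω in (-π)..π, k ω) - c * π)) := by
  have hpi := Real.pi_pos
  have huIcc : Set.uIcc (-π) π = Set.Icc (-π) π := Set.uIcc_of_le (by linarith)
  have hlim : Filter.Tendsto (fun ε : ℝ => c * -((π - ε : ℝ) : ℂ)) (nhdsWithin 0 (Set.Ioi 0))
      (nhds (c * -(π : ℂ))) := by
    refine tendsto_nhdsWithin_of_tendsto_nhds ?_
    have : Continuous fun ε : ℝ => c * -((π - ε : ℝ) : ℂ) := by fun_prop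
    simpa using this.tendsto 0
  rw [show (∫ ω in (-π)..π, k ω) - c * π = (∫ ω in (-π)..π, k ω) + c * -(π : ℂ) by ring]
  refine ((tendsto_setIntegral_annulus hk).add hlim).congr' ?_
  filter_upwards [Ioc_mem_nhdsGT hpi] with ε hε
  have hsub : {ω : ℝ | ε ≤ |ω| ∧ |ω| ≤ π} ⊆ Set.uIcc (-π) π :=
    fun ω hω => huIcc ▸ abs_le.1 hω.2
  have hne : ∀ ω ∈ {ω : ℝ | ε ≤ |ω| ∧ |ω| ≤ π}, Complex.exp (-Complex.I * (ω : ℂ)) - 1 ≠ 0 :=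
    fun ω hω => exp_neg_I_mul_ofReal_ne_one (abs_pos.1 (hε.1.trans_le hω.1)) hω.2
  have hclosed : IsClosed {ω : ℝ | ε ≤ |ω| ∧ |ω| ≤ π} := by
    rw [setOf_le_abs_eq_union hε.1]; exact isClosed_Icc.union isClosed_Icc
  have hcomp : IsCompact {ω : ℝ | ε ≤ |ω| ∧ |ω| ≤ π} :=
    isCompact_uIcc.of_isClosed_subset hclosed hsub
  have hinv : ContinuousOn (fun ω : ℝ => c * (Complex.exp (-Complex.I * (ω : ℂ)) - 1)⁻¹)
      {ω : ℝ | ε ≤ |ω| ∧ |ω| ≤ π} :=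
    continuousOn_const.mul (ContinuousOn.inv₀ (by fun_prop) hne)
  rw [← setIntegral_annulus_inv_exp_sub_one hε.1 hε.2, ← integral_const_mul,
    ← integral_add ((hk.mono hsub).integrableOn_compact hcomp) (hinv.integrableOn_compact hcomp)]
  refine setIntegral_congr_fun hclosed.measurableSet fun ω hω => ?_
  have hω' := hne ω hω
  simp only [h ω (hsub hω)]
  rw [add_div, mul_div_cancel_left₀ _ hω', div_eq_mul_inv, add_comm]

lemma exp_phase_of_nonneg {α : ℝ} (hα : 0 ≤ α) (n : ℕ) :
    Complex.exp ((π : ℂ) * Complex.I * ((|((n : ℤ) : ℝ)| - |((n : ℤ) : ℝ) + α| : ℝ) : ℂ)) =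
      Complex.exp (-((π * α : ℝ) : ℂ) * Complex.I) := by
  have hn : (0 : ℝ) ≤ n := n.cast_nonneg
  rw [Int.cast_natCast, abs_of_nonneg hn, abs_of_nonneg (add_nonneg hn hα)]
  congr 1; push_cast; ring

lemma exp_phase_of_neg {α : ℝ} (hα : α ≤ 1) (n : ℕ) :
    Complex.exp ((π : ℂ) * Complex.I *
      ((|((-((n : ℤ) + 1) : ℤ) : ℝ)| - |((-((n : ℤ) + 1) : ℤ) : ℝ) + α| : ℝ) : ℂ)) =
      Complex.exp (((π * α : ℝ) : ℂ) * Complex.I) := by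
  have hn : (0 : ℝ) ≤ n := n.cast_nonneg
  push_cast
  rw [abs_of_nonpos (by linarith), abs_of_nonpos (by linarith)]
  congr 1; push_cast; ring

/-- The sum of the nonnegative-frequency Fourier coefficients. -/
lemma hasSum_fourierCoeffPer_natCast {g k : ℝ → ℂ} {c : ℂ}
    (hsum : Summable fun ℓ : ℤ => ‖fourierCoeffPer g ℓ‖)
    (h : ∀ ℓ : ℤ, fourierCoeffPer g ℓ =
      (if ℓ = 0 then c else 0) + (fourierCoeffPer k (ℓ + 1) - fourierCoeffPer k ℓ)) :
    HasSum (fun n : ℕ => fourierCoeffPer g (n : ℤ)) (c - fourierCoeffPer k 0) := by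
  have hs : Summable fun n : ℕ => fourierCoeffPer g (n : ℤ) :=
    (hsum.comp_injective Nat.cast_injective).of_norm
  rw [hs.hasSum_iff_tendsto_nat, ← Filter.tendsto_add_atTop_iff_nat 1]
  have hpart : ∀ N : ℕ, ∑ n ∈ Finset.range (N + 1), fourierCoeffPer g (n : ℤ) =
      c - fourierCoeffPer k 0 + fourierCoeffPer k ((N + 1 : ℕ) : ℤ) := by
    intro N
    induction N with
    | zero => simp [h]; ring
    | succ N ih =>
      rw [Finset.sum_range_succ, ih, h, if_neg (by omega)]
      push_cast
      ring
  simp only [hpart]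
  have hlim : Filter.Tendsto (fun N : ℕ => fourierCoeffPer k ((N + 1 : ℕ) : ℤ)) Filter.atTop
      (nhds 0) := by
    rw [← Nat.cofinite_eq_atTop]
    exact (tendsto_fourierCoeffPer_cofinite k).comp
      (Function.Injective.tendsto_cofinite fun a b hab => by simpa using hab)
  simpa using hlim.const_add (c - fourierCoeffPer k 0)

/-- The sum of the negative-frequency Fourier coefficients. -/
lemma hasSum_fourierCoeffPer_neg {g k : ℝ → ℂ} {c : ℂ}
    (hsum : Summable fun ℓ : ℤ => ‖fourierCoeffPer g ℓ‖)
    (h : ∀ ℓ : ℤ, fourierCoeffPer g ℓ =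
      (if ℓ = 0 then c else 0) + (fourierCoeffPer k (ℓ + 1) - fourierCoeffPer k ℓ)) :
    HasSum (fun n : ℕ => fourierCoeffPer g (-((n : ℤ) + 1))) (fourierCoeffPer k 0) := by
  have hs : Summable fun n : ℕ => fourierCoeffPer g (-((n : ℤ) + 1)) :=
    (hsum.comp_injective (i := fun n : ℕ => -((n : ℤ) + 1))
      fun a b hab => by simpa using hab).of_norm
  rw [hs.hasSum_iff_tendsto_nat]
  have hpart : ∀ N : ℕ, ∑ n ∈ Finset.range N, fourierCoeffPer g (-((n : ℤ) + 1)) =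
      fourierCoeffPer k 0 - fourierCoeffPer k (-(N : ℤ)) := by
    intro N
    induction N with
    | zero => simp
    | succ N ih =>
      rw [Finset.sum_range_succ, ih, h, if_neg (by omega),
        show -((N : ℤ) + 1) + 1 = -(N : ℤ) by ring]
      push_cast
      ring
  simp only [hpart]
  have hlim : Filter.Tendsto (fun N : ℕ => fourierCoeffPer k (-(N : ℤ))) Filter.atTop
      (nhds 0) := by
    rw [← Nat.cofinite_eq_atTop]
    exact (tendsto_fourierCoeffPer_cofinite k).comp
      (Function.Injective.tendsto_cofinite fun a b hab => by simpa using hab)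
  simpa using hlim.const_sub (fourierCoeffPer k 0)

/-- The (energy-independent) scattering matrix of the Friedrichs Aharonov–Bohm
Hamiltonian: for smooth `2π`-periodic `g`, the series `Σ_ℓ e^{iπ(|ℓ|-|ℓ+α|)} ĝ(ℓ)`
converges absolutely, the principal value `P.V. ∫ g(ω)/(e^{-iω}-1) dω` exists, and
`Σ_ℓ e^{iπ(|ℓ|-|ℓ+α|)} ĝ(ℓ) = cos(πα) g(0) + (i/π) sin(πα) · P.V. ∫ g(ω)/(e^{-iω}-1) dω`. -/
theorem ab_friedrichs_scattering_matrix (α : ℝ) (hα : α ∈ Set.Ioo (0 : ℝ) 1)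
    (g : ℝ → ℂ) (hg : ContDiff ℝ (⊤ : ℕ∞) g) (hper : Function.Periodic g (2 * π)) :
    Summable (fun ℓ : ℤ =>
      ‖Complex.exp ((π : ℂ) * Complex.I * ((|(ℓ : ℝ)| - |(ℓ : ℝ) + α| : ℝ) : ℂ)) *
        fourierCoeffPer g ℓ‖) ∧
    ∃ L : ℂ,
      Filter.Tendsto
        (fun ε : ℝ => ∫ ω in {ω : ℝ | ε ≤ |ω| ∧ |ω| ≤ π},
          g ω / (Complex.exp (-Complex.I * (ω : ℂ)) - 1))
        (nhdsWithin 0 (Set.Ioi 0)) (nhds L) ∧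
      ∑' ℓ : ℤ, Complex.exp ((π : ℂ) * Complex.I * ((|(ℓ : ℝ)| - |(ℓ : ℝ) + α| : ℝ) : ℂ)) *
          fourierCoeffPer g ℓ =
        ((Real.cos (π * α) : ℝ) : ℂ) * g 0 +
          (Complex.I / (π : ℂ)) * ((Real.sin (π * α) : ℝ) : ℂ) * L := by
  have hg2 : ContDiff ℝ 2 g := contDiff_infty.1 hg 2
  have hsum := summable_norm_fourierCoeffPer hg2 hper
  obtain ⟨k, hk, hgk⟩ := exists_continuousOn_quotient (hg2.of_le one_le_two)
  have hcoeff := fourierCoeffPer_eq_sub hk.intervalIntegrable hgk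
  refine ⟨?_, _, tendsto_setIntegral_annulus_div hk hgk, ?_⟩
  · refine hsum.congr fun ℓ => ?_
    rw [norm_mul, Complex.norm_exp]
    simp
  · have hpos := (hasSum_fourierCoeffPer_natCast hsum hcoeff).mul_left
      (Complex.exp (-((π * α : ℝ) : ℂ) * Complex.I))
    have hneg := (hasSum_fourierCoeffPer_neg hsum hcoeff).mul_left
      (Complex.exp (((π * α : ℝ) : ℂ) * Complex.I))
    have htot := HasSum.of_nat_of_neg_add_one
      (f := fun ℓ : ℤ =>
        Complex.exp ((π : ℂ) * Complex.I * ((|(ℓ : ℝ)| - |(ℓ : ℝ) + α| : ℝ) : ℂ)) *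
          fourierCoeffPer g ℓ)
      (hpos.congr_fun fun n => by rw [exp_phase_of_nonneg hα.1.le])
      (hneg.congr_fun fun n => by rw [exp_phase_of_neg hα.2.le])
    have hpi : (π : ℂ) ≠ 0 := by exact_mod_cast Real.pi_ne_zero
    have hk0 : ∫ ω in (-π)..π, k ω = 2 * π * fourierCoeffPer k 0 := by
      simp [fourierCoeffPer]
      field_simp
    rw [htot.tsum_eq, hk0, Complex.exp_mul_I, Complex.exp_mul_I, Complex.cos_neg, Complex.sin_neg,
      Complex.ofReal_cos, Complex.ofReal_sin]
    field_simp
    ring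

end
end
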